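/- arXiv:2309.02749 — 3 statements merged into one kernel-verified Lean document; each statement's English description precedes it below -/
import Mathlib

section
/- Let G be an unambiguous context-free grammar generating a non-regular language. Then dnreg_G(n) ∈ Ω(n), i.e., limsup_{n→∞} dnreg_G(n)/n > 0. -/
/-- A context-free rule is *regular* (right-linear) if it has the form `A → w` or `A → wB`
for a terminal word `w` and a nonterminal `B`. -/
def IsRegularRule {T N : Type} (r : ContextFreeRule T N) : Prop :=
  (∃ w : List T, r.output = w.map Symbol.terminal) ∨
  (∃ w : List T, ∃ B : N, r.output = w.map Symbol.terminal ++ [Symbol.nonterminal B])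

/-- `DerivesN g u v k` : the grammar `g` derives `v` from `u` by a derivation using exactly `k`
applications of non-regular rules. -/
inductive DerivesN (g : ContextFreeGrammar T) :
    List (Symbol T g.NT) → List (Symbol T g.NT) → ℕ → Prop
  | refl (u : List (Symbol T g.NT)) : DerivesN g u u 0
  | regStep {u v w : List (Symbol T g.NT)} {k : ℕ} (r : ContextFreeRule T g.NT)
      (hr : r ∈ g.rules) (hreg : IsRegularRule r) (huv : r.Rewrites u v)
      (hvw : DerivesN g v w k) : DerivesN g u w k
  | nonregStep {u v w : List (Symbol T g.NT)} {k : ℕ} (r : ContextFreeRule T g.NT)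
      (hr : r ∈ g.rules) (hreg : ¬ IsRegularRule r) (huv : r.Rewrites u v)
      (hvw : DerivesN g v w k) : DerivesN g u w (k + 1)

/-- The degree of non-regularity of a terminal word: the minimal number of applications of
non-regular rules over all derivations of the word (`0` if there is no derivation, since in `ℕ`
the infimum of the empty set is `0`). -/
noncomputable def dnregWord (g : ContextFreeGrammar T) (w : List T) : ℕ :=
  sInf {k | DerivesN g [Symbol.nonterminal g.initial] (w.map Symbol.terminal) k}

/-- The degree of non-regularity of the grammar: the maximum of `dnregWord` over words of
length `n`. -/
noncomputable def dnregFun (g : ContextFreeGrammar T) (n : ℕ) : ℕ :=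
  sSup {m | ∃ w : List T, w.length = n ∧ dnregWord g w = m}

/-- `f ∈ O(h)` for `ℕ`-valued functions. -/
def InO (f h : ℕ → ℕ) : Prop := ∃ c : ℕ, ∀ n, f n ≤ c * h n + c

/-- `f ∈ Ω(n)`: there is a rational constant `1/c > 0` with `f n ≥ n/c` for infinitely many `n`. -/
def InOmegaLinear (f : ℕ → ℕ) : Prop := ∃ c : ℕ, 0 < c ∧ ∀ m : ℕ, ∃ n ≥ m, n ≤ c * f n

/-- The class `DNREG(h)` of languages generated by some context-free grammar whose degree of
non-regularity is in `O(h)`. -/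
def DNREG (T : Type) (h : ℕ → ℕ) : Set (Language T) :=
  {L | ∃ g : ContextFreeGrammar T, g.language = L ∧ InO (dnregFun g) h}

/-- `r.RewritesLeftmost u v` : rule `r` rewrites the leftmost nonterminal of `u`, giving `v`. -/
def RewritesLeftmost {T N : Type} (r : ContextFreeRule T N) (u v : List (Symbol T N)) : Prop :=
  ∃ p s : List (Symbol T N), (∀ x ∈ p, ∃ t : T, x = Symbol.terminal t) ∧
    u = p ++ [Symbol.nonterminal r.input] ++ s ∧ v = p ++ r.output ++ s

/-- A leftmost derivation in `g` from `u` to `v` using the listed sequence of rules. -/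
inductive LeftDeriv (g : ContextFreeGrammar T) :
    List (Symbol T g.NT) → List (Symbol T g.NT) → List (ContextFreeRule T g.NT) → Prop
  | refl (u : List (Symbol T g.NT)) : LeftDeriv g u u []
  | step {u v w : List (Symbol T g.NT)} {rs : List (ContextFreeRule T g.NT)}
      (r : ContextFreeRule T g.NT) (hr : r ∈ g.rules) (huv : RewritesLeftmost r u v)
      (hvw : LeftDeriv g v w rs) : LeftDeriv g u w (r :: rs)

/-- A grammar is unambiguous if every word of its language has exactly one leftmost
derivation. -/
def Unambiguous (g : ContextFreeGrammar T) : Prop :=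
  ∀ w ∈ g.language,
    ∃! rs : List (ContextFreeRule T g.NT),
      LeftDeriv g [Symbol.nonterminal g.initial] (w.map Symbol.terminal) rs

section GrammarDerivations

variable {T : Type} {g : ContextFreeGrammar T}

open Classical in
/-- The number of non-regular rules in a list of rules. -/
noncomputable def nonregCount {N : Type} (rs : List (ContextFreeRule T N)) : ℕ :=
  rs.countP (fun r => ¬ IsRegularRule r)

theorem nonregCount_append {N : Type} (rs ss : List (ContextFreeRule T N)) :
    nonregCount (rs ++ ss) = nonregCount rs + nonregCount ss := by
  simp [nonregCount]

theorem nonregCount_cons_of_regular {N : Type} {r : ContextFreeRule T N}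
    (h : IsRegularRule r) (rs : List (ContextFreeRule T N)) :
    nonregCount (r :: rs) = nonregCount rs := by
  simp [nonregCount, h]

theorem nonregCount_cons_of_not_regular {N : Type} {r : ContextFreeRule T N}
    (h : ¬ IsRegularRule r) (rs : List (ContextFreeRule T N)) :
    nonregCount (r :: rs) = nonregCount rs + 1 := by
  simp [nonregCount, h]

/-- `Yields g s w rs`: the sentential form `s` has a derivation forest with yield `w` whose
rules, listed in preorder, are `rs`. -/
inductive Yields (g : ContextFreeGrammar T) :
    List (Symbol T g.NT) → List T → List (ContextFreeRule T g.NT) → Prop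
  | nil : Yields g [] [] []
  | terminal (t : T) {s : List (Symbol T g.NT)} {w : List T} {rs : List (ContextFreeRule T g.NT)}
      (h : Yields g s w rs) : Yields g (Symbol.terminal t :: s) (t :: w) rs
  | rule {s : List (Symbol T g.NT)} {u v : List T} {rs ss : List (ContextFreeRule T g.NT)}
      (r : ContextFreeRule T g.NT) (hr : r ∈ g.rules) (hu : Yields g r.output u rs)
      (hv : Yields g s v ss) :
      Yields g (Symbol.nonterminal r.input :: s) (u ++ v) (r :: (rs ++ ss))

theorem Yields.map_terminal (w : List T) : Yields g (w.map Symbol.terminal) w [] := by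
  induction w with
  | nil => exact .nil
  | cons t w ih => exact .terminal t ih

theorem Yields.append {s s' : List (Symbol T g.NT)} {w w' : List T}
    {rs rs' : List (ContextFreeRule T g.NT)} (h : Yields g s w rs) (h' : Yields g s' w' rs') :
    Yields g (s ++ s') (w ++ w') (rs ++ rs') := by
  induction h with
  | nil => simpa using h'
  | terminal t _ ih => exact .terminal t ih
  | rule r hr hu _ _ ih => simpa using Yields.rule r hr hu ih

theorem Yields.exists_of_append {s : List (Symbol T g.NT)} {w : List T}
    {rs : List (ContextFreeRule T g.NT)} (h : Yields g s w rs) {s₁ s₂ : List (Symbol T g.NT)}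
    (hs : s = s₁ ++ s₂) :
    ∃ w₁ w₂ rs₁ rs₂, Yields g s₁ w₁ rs₁ ∧ Yields g s₂ w₂ rs₂ ∧ w = w₁ ++ w₂ ∧
      rs = rs₁ ++ rs₂ := by
  induction h generalizing s₁ with
  | nil =>
    obtain ⟨rfl, rfl⟩ := List.append_eq_nil_iff.mp hs.symm
    exact ⟨[], [], [], [], .nil, .nil, rfl, rfl⟩
  | @terminal t s w rs h ih =>
    cases s₁ with
    | nil =>
      obtain rfl : _ = s₂ := hs
      exact ⟨[], _, [], _, .nil, .terminal t h, rfl, rfl⟩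
    | cons a s₁ =>
      obtain ⟨rfl, hs'⟩ := List.cons_eq_cons.mp hs
      obtain ⟨w₁, w₂, rs₁, rs₂, h₁, h₂, rfl, rfl⟩ := ih hs'
      exact ⟨_, _, _, _, .terminal t h₁, h₂, rfl, rfl⟩
  | @rule s u v rs ss r hr hu hv _ ih =>
    cases s₁ with
    | nil =>
      obtain rfl : _ = s₂ := hs
      exact ⟨[], _, [], _, .nil, .rule r hr hu hv, rfl, rfl⟩
    | cons a s₁ =>
      obtain ⟨rfl, hs'⟩ := List.cons_eq_cons.mp hs
      obtain ⟨w₁, w₂, rs₁, rs₂, h₁, h₂, rfl, rfl⟩ := ih hs'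
      exact ⟨_, _, _, _, .rule r hr hu h₁, h₂, by simp, by simp⟩

theorem Yields.of_rewrites {r : ContextFreeRule T g.NT} (hr : r ∈ g.rules)
    {u v : List (Symbol T g.NT)} (huv : r.Rewrites u v) {w : List T}
    {rs : List (ContextFreeRule T g.NT)} (h : Yields g v w rs) :
    ∃ rs', Yields g u w rs' ∧ nonregCount rs' = nonregCount (r :: rs) := by
  obtain ⟨p, q, rfl, rfl⟩ := huv.exists_parts
  obtain ⟨w₁, w₂, rs₁, rs₂, h₁, h₂, rfl, rfl⟩ := h.exists_of_append rfl
  obtain ⟨w₃, w₄, rs₃, rs₄, h₃, h₄, rfl, rfl⟩ := h₁.exists_of_append rfl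
  refine ⟨rs₃ ++ (r :: (rs₄ ++ rs₂)), ?_, ?_⟩
  · simpa using h₃.append (.rule r hr h₄ h₂)
  · by_cases hreg : IsRegularRule r
    · simp only [nonregCount_append, nonregCount_cons_of_regular hreg]
      ring
    · simp only [nonregCount_append, nonregCount_cons_of_not_regular hreg]
      ring

theorem DerivesN.exists_yields {s s' : List (Symbol T g.NT)} {k : ℕ} (h : DerivesN g s s' k)
    {w : List T} (hw : s' = w.map Symbol.terminal) :
    ∃ rs, Yields g s w rs ∧ nonregCount rs = k := by
  induction h with
  | refl u => exact ⟨[], hw ▸ .map_terminal w, rfl⟩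
  | regStep r hr hreg huv _ ih =>
    obtain ⟨rs, hrs, rfl⟩ := ih hw
    rw [← nonregCount_cons_of_regular hreg rs]
    exact hrs.of_rewrites hr huv
  | nonregStep r hr hreg huv _ ih =>
    obtain ⟨rs, hrs, rfl⟩ := ih hw
    rw [← nonregCount_cons_of_not_regular hreg rs]
    exact hrs.of_rewrites hr huv

theorem LeftDeriv.trans {u v w : List (Symbol T g.NT)} {rs ss : List (ContextFreeRule T g.NT)}
    (h : LeftDeriv g u v rs) (h' : LeftDeriv g v w ss) : LeftDeriv g u w (rs ++ ss) := by
  induction h with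
  | refl => exact h'
  | step r hr huv _ ih => exact .step r hr huv (ih h')

theorem Yields.leftDeriv {s : List (Symbol T g.NT)} {w : List T}
    {rs : List (ContextFreeRule T g.NT)} (h : Yields g s w rs) (p : List T)
    (q : List (Symbol T g.NT)) :
    LeftDeriv g (p.map Symbol.terminal ++ s ++ q)
      (p.map Symbol.terminal ++ w.map Symbol.terminal ++ q) rs := by
  induction h generalizing p q with
  | nil => exact .refl _
  | terminal t _ ih => simpa using ih (p ++ [t]) q
  | @rule s u v rs ss r hr _ _ ihu ihv =>
    refine .step (v := p.map Symbol.terminal ++ r.output ++ (s ++ q)) r hr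
      ⟨p.map Symbol.terminal, s ++ q, by simp, by simp, rfl⟩ ?_
    refine (ihu p (s ++ q)).trans ?_
    simpa using ihv (p ++ u) q

theorem DerivesN.trans {u v w : List (Symbol T g.NT)} {k l : ℕ} (h : DerivesN g u v k)
    (h' : DerivesN g v w l) : DerivesN g u w (k + l) := by
  induction h with
  | refl => simpa using h'
  | regStep r hr hreg huv _ ih => exact .regStep r hr hreg huv (ih h')
  | nonregStep r hr hreg huv _ ih =>
    rw [Nat.add_right_comm]
    exact .nonregStep r hr hreg huv (ih h')

theorem DerivesN.append_left {u v : List (Symbol T g.NT)} {k : ℕ} (h : DerivesN g u v k)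
    (p : List (Symbol T g.NT)) : DerivesN g (p ++ u) (p ++ v) k := by
  induction h with
  | refl => exact .refl _
  | regStep r hr hreg huv _ ih => exact .regStep r hr hreg (huv.append_left p) ih
  | nonregStep r hr hreg huv _ ih => exact .nonregStep r hr hreg (huv.append_left p) ih

theorem DerivesN.append_right {u v : List (Symbol T g.NT)} {k : ℕ} (h : DerivesN g u v k)
    (p : List (Symbol T g.NT)) : DerivesN g (u ++ p) (v ++ p) k := by
  induction h with
  | refl => exact .refl _
  | regStep r hr hreg huv _ ih => exact .regStep r hr hreg (huv.append_right p) ih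
  | nonregStep r hr hreg huv _ ih => exact .nonregStep r hr hreg (huv.append_right p) ih

theorem DerivesN.derives {u v : List (Symbol T g.NT)} {k : ℕ} (h : DerivesN g u v k) :
    g.Derives u v := by
  induction h with
  | refl => exact .refl _
  | regStep r hr _ huv _ ih => exact .head ⟨r, hr, huv⟩ ih
  | nonregStep r hr _ huv _ ih => exact .head ⟨r, hr, huv⟩ ih

theorem DerivesN.exists_of_derives {u v : List (Symbol T g.NT)} (h : g.Derives u v) :
    ∃ k, DerivesN g u v k := by
  induction h using Relation.ReflTransGen.head_induction_on with
  | refl => exact ⟨0, .refl _⟩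
  | head h _ ih =>
    obtain ⟨r, hr, huv⟩ := h
    obtain ⟨k, hk⟩ := ih
    by_cases hreg : IsRegularRule r
    · exact ⟨k, .regStep r hr hreg huv hk⟩
    · exact ⟨k + 1, .nonregStep r hr hreg huv hk⟩

theorem DerivesN.of_rule {r : ContextFreeRule T g.NT} (hr : r ∈ g.rules) :
    ∃ k, DerivesN g [Symbol.nonterminal r.input] r.output k ∧ (¬ IsRegularRule r → 1 ≤ k) := by
  by_cases hreg : IsRegularRule r
  · exact ⟨0, .regStep r hr hreg .input_output (.refl _), fun h => (h hreg).elim⟩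
  · exact ⟨1, .nonregStep r hr hreg .input_output (.refl _), fun _ => le_rfl⟩

theorem LeftDeriv.derives {u v : List (Symbol T g.NT)} {rs : List (ContextFreeRule T g.NT)}
    (h : LeftDeriv g u v rs) : g.Derives u v := by
  induction h with
  | refl => exact .refl _
  | step r hr huv _ ih =>
    obtain ⟨p, s, _, rfl, rfl⟩ := huv
    exact .head ⟨r, hr, r.rewrites_of_exists_parts p s⟩ ih

theorem Yields.derives {s : List (Symbol T g.NT)} {w : List T}
    {rs : List (ContextFreeRule T g.NT)} (h : Yields g s w rs) :
    g.Derives s (w.map Symbol.terminal) := by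
  simpa using (h.leftDeriv [] []).derives

/-- In an unambiguous grammar the degree of non-regularity of a word is the number of non-regular
rules of any of its derivations. -/
theorem Unambiguous.dnregWord_eq (hu : Unambiguous g) {w : List T} {k : ℕ}
    (h : DerivesN g [Symbol.nonterminal g.initial] (w.map Symbol.terminal) k) :
    dnregWord g w = k := by
  have huniq : ∀ l, DerivesN g [Symbol.nonterminal g.initial] (w.map Symbol.terminal) l →
      l = k := by
    intro l hl
    obtain ⟨rs, hrs, rfl⟩ := h.exists_yields rfl
    obtain ⟨ss, hss, rfl⟩ := hl.exists_yields rfl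
    have h₁ : LeftDeriv g [Symbol.nonterminal g.initial] (w.map Symbol.terminal) rs := by
      simpa using hrs.leftDeriv [] []
    have h₂ : LeftDeriv g [Symbol.nonterminal g.initial] (w.map Symbol.terminal) ss := by
      simpa using hss.leftDeriv [] []
    rw [(hu w hrs.derives).unique h₁ h₂]
  exact huniq _ (Nat.sInf_mem ⟨k, h⟩)

/-- The symbols that can occur in the sentential forms of a grammar. -/
def ContextFreeGrammar.symbols (g : ContextFreeGrammar T) : Set (Symbol T g.NT) :=
  insert (Symbol.nonterminal g.initial) (⋃ r ∈ g.rules, {x | x ∈ r.output})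

theorem ContextFreeGrammar.finite_symbols (g : ContextFreeGrammar T) : g.symbols.Finite :=
  (g.rules.finite_toSet.biUnion fun r _ => List.finite_toSet r.output).insert _

theorem ContextFreeGrammar.Derives.mem_symbols {s : List (Symbol T g.NT)}
    (h : g.Derives [Symbol.nonterminal g.initial] s) : ∀ x ∈ s, x ∈ g.symbols := by
  induction h with
  | refl => simp [ContextFreeGrammar.symbols]
  | tail _ hbc ih =>
    obtain ⟨r, hr, hbc⟩ := hbc
    obtain ⟨p, q, rfl, rfl⟩ := hbc.exists_parts
    intro x hx
    simp only [List.append_assoc, List.mem_append, List.mem_singleton] at hx ih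
    rcases hx with hx | hx | hx
    · exact ih x (.inl hx)
    · exact .inr (Set.mem_biUnion hr hx)
    · exact ih x (.inr (.inr hx))

theorem Set.Finite.lists_length_le {α : Type*} {S : Set α} (hS : S.Finite) (n : ℕ) :
    {l : List α | l.length ≤ n ∧ ∀ x ∈ l, x ∈ S}.Finite := by
  have := hS.to_subtype
  refine ((List.finite_length_le S n).image (List.map Subtype.val)).subset ?_
  rintro l ⟨hl, hlS⟩
  lift l to List S using hlS
  exact ⟨l, by simpa using hl, rfl⟩

theorem dnregWord_le_dnregFun (g : ContextFreeGrammar T) (w : List T) :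
    dnregWord g w ≤ dnregFun g w.length := by
  refine le_csSup (Set.Finite.bddAbove ?_) ⟨w, rfl, rfl⟩
  have hfin : (Symbol.terminal ⁻¹' g.symbols : Set T).Finite :=
    g.finite_symbols.preimage fun a _ b _ h => Symbol.terminal.inj h
  refine (((hfin.lists_length_le w.length).image (dnregWord g)).insert 0).subset ?_
  rintro m ⟨v, hv, rfl⟩
  by_cases hvL : v ∈ g.language
  · refine .inr ⟨v, ⟨hv.le, fun x hx => ?_⟩, rfl⟩
    exact ContextFreeGrammar.Derives.mem_symbols hvL _ (List.mem_map_of_mem hx)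
  · left
    rw [dnregWord, Nat.sInf_eq_zero]
    right
    ext k
    simpa using fun hk : DerivesN g _ _ k => hvL hk.derives

/-- A rule is productive if its output derives a terminal word. -/
def IsProductive (g : ContextFreeGrammar T) (r : ContextFreeRule T g.NT) : Prop :=
  ∃ w rs, Yields g r.output w rs

/-- `UsefulEdge g A B`: some productive rule for `A` has `B` in its output. -/
def UsefulEdge (g : ContextFreeGrammar T) (A B : g.NT) : Prop :=
  ∃ r ∈ g.rules, IsProductive g r ∧ r.input = A ∧ Symbol.nonterminal B ∈ r.output

theorem IsProductive.exists_derivesN {r : ContextFreeRule T g.NT} (hp : IsProductive g r)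
    (hr : r ∈ g.rules) {B : g.NT} (hB : Symbol.nonterminal B ∈ r.output) :
    ∃ (u v : List T) (k : ℕ), DerivesN g [Symbol.nonterminal r.input]
      (u.map Symbol.terminal ++ [Symbol.nonterminal B] ++ v.map Symbol.terminal) k ∧
      (¬ IsRegularRule r → 1 ≤ k) := by
  obtain ⟨k, hk, hk1⟩ := DerivesN.of_rule hr
  obtain ⟨w, rs, h⟩ := hp
  obtain ⟨p, q, hpq⟩ := List.append_of_mem hB
  obtain ⟨u, _, _, _, hu, h', -, -⟩ := h.exists_of_append hpq
  obtain ⟨_, v, _, _, -, hv, -, -⟩ :=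
    h'.exists_of_append (s₁ := [Symbol.nonterminal B]) (s₂ := q) rfl
  obtain ⟨k₁, hk₁⟩ := DerivesN.exists_of_derives hu.derives
  obtain ⟨k₂, hk₂⟩ := DerivesN.exists_of_derives hv.derives
  refine ⟨u, v, k + (k₁ + k₂), hk.trans ?_, fun h => (hk1 h).trans (Nat.le_add_right _ _)⟩
  have h₁ := hk₁.append_right ([Symbol.nonterminal B] ++ q)
  have h₂ := hk₂.append_left (u.map Symbol.terminal ++ [Symbol.nonterminal B])
  rw [List.append_assoc] at h₂
  rw [hpq]
  exact h₁.trans h₂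

theorem exists_derivesN_of_reach {A B : g.NT}
    (h : Relation.ReflTransGen (UsefulEdge g) A B) :
    ∃ (u v : List T) (k : ℕ), DerivesN g [Symbol.nonterminal A]
      (u.map Symbol.terminal ++ [Symbol.nonterminal B] ++ v.map Symbol.terminal) k := by
  induction h with
  | refl => exact ⟨[], [], 0, .refl _⟩
  | tail _ hbc ih =>
    obtain ⟨r, hr, hp, rfl, hB⟩ := hbc
    obtain ⟨u, v, k, hk⟩ := ih
    obtain ⟨u', v', k', hk', -⟩ := hp.exists_derivesN hr hB
    refine ⟨u ++ u', v' ++ v, k + k', hk.trans ?_⟩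
    simpa using (hk'.append_left (u.map Symbol.terminal)).append_right (v.map Symbol.terminal)

theorem DerivesN.iterate {A : g.NT} {u v : List T} {k : ℕ}
    (h : DerivesN g [Symbol.nonterminal A]
      (u.map Symbol.terminal ++ [Symbol.nonterminal A] ++ v.map Symbol.terminal) k) (i : ℕ) :
    ∃ u' v' : List T, u'.length + v'.length = (u.length + v.length) * i ∧
      DerivesN g [Symbol.nonterminal A]
        (u'.map Symbol.terminal ++ [Symbol.nonterminal A] ++ v'.map Symbol.terminal) (k * i) := by
  induction i with
  | zero => exact ⟨[], [], rfl, .refl _⟩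
  | succ i ih =>
    obtain ⟨u', v', hl, h'⟩ := ih
    refine ⟨u' ++ u, v ++ v', ?_, ?_⟩
    · simp only [List.length_append, Nat.mul_succ]
      omega
    · refine h'.trans ?_
      simpa using (h.append_left (u'.map Symbol.terminal)).append_right (v'.map Symbol.terminal)

/-- If a reachable nonterminal can reproduce itself through a non-regular rule, then the degree of
non-regularity of an unambiguous grammar grows at least linearly. -/
theorem Unambiguous.inOmegaLinear_of_loop (hu : Unambiguous g) {r : ContextFreeRule T g.NT}
    (hr : r ∈ g.rules) (hreg : ¬ IsRegularRule r) (hp : IsProductive g r)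
    (hreach : Relation.ReflTransGen (UsefulEdge g) g.initial r.input) {B : g.NT}
    (hB : Symbol.nonterminal B ∈ r.output)
    (hloop : Relation.ReflTransGen (UsefulEdge g) B r.input) :
    InOmegaLinear (dnregFun g) := by
  obtain ⟨x, z, k₀, hk₀⟩ := exists_derivesN_of_reach hreach
  obtain ⟨u₁, v₁, k₁, hk₁, hpos⟩ := hp.exists_derivesN hr hB
  obtain ⟨u₂, v₂, k₂, hk₂⟩ := exists_derivesN_of_reach hloop
  obtain ⟨y, k₃, hk₃⟩ : ∃ (y : List T) (k : ℕ),
      DerivesN g [Symbol.nonterminal r.input] (y.map Symbol.terminal) k := by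
    obtain ⟨y, rs, hy⟩ := hp
    obtain ⟨l, hl⟩ := DerivesN.exists_of_derives hy.derives
    obtain ⟨k, hk, -⟩ := DerivesN.of_rule hr
    exact ⟨y, _, hk.trans hl⟩
  have hcycle : DerivesN g [Symbol.nonterminal r.input] ((u₁ ++ u₂).map Symbol.terminal ++
      [Symbol.nonterminal r.input] ++ (v₂ ++ v₁).map Symbol.terminal) (k₁ + k₂) := by
    refine hk₁.trans ?_
    simpa using (hk₂.append_left (u₁.map Symbol.terminal)).append_right (v₁.map Symbol.terminal)
  set b := (u₁ ++ u₂).length + (v₂ ++ v₁).length with hb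
  set a := x.length + y.length + z.length with ha
  have key : ∀ i, i ≤ dnregFun g (a + b * i) := by
    intro i
    obtain ⟨u, v, hl, h⟩ := hcycle.iterate i
    have h₁ := h.trans ((hk₃.append_left (u.map Symbol.terminal)).append_right
      (v.map Symbol.terminal))
    have h₂ := hk₀.trans ((h₁.append_left (x.map Symbol.terminal)).append_right
      (z.map Symbol.terminal))
    have h₃ := hu.dnregWord_eq (w := x ++ (u ++ y ++ v) ++ z) (by simpa using h₂)
    have h₄ := dnregWord_le_dnregFun g (x ++ (u ++ y ++ v) ++ z)
    have hlen : (x ++ (u ++ y ++ v) ++ z).length = a + b * i := by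
      simp only [List.length_append] at hl hb ha ⊢
      rw [hb, ← hl]
      omega
    rw [hlen, h₃] at h₄
    have : 1 * i ≤ (k₁ + k₂) * i :=
      Nat.mul_le_mul_right i ((hpos hreg).trans (Nat.le_add_right _ _))
    omega
  have hb0 : b ≠ 0 := by
    intro h0
    have := key (dnregFun g a + 1)
    simp [h0] at this
  refine ⟨a + b, by omega, fun m => ⟨a + b * (m + 1), ?_, ?_⟩⟩
  · have : 1 * (m + 1) ≤ b * (m + 1) := Nat.mul_le_mul_right _ (by omega)
    omega
  · calc a + b * (m + 1) ≤ (a + b) * (m + 1) := by nlinarith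
      _ ≤ _ := Nat.mul_le_mul_left _ (key _)

/-- If non-regular rules strictly decrease a rank and regular rules do not increase it, every
split of a derived word is witnessed by a remainder of bounded length. -/
theorem Yields.exists_remainder {R : g.NT → Prop} {rank : g.NT → ℕ} {M : ℕ}
    (hM : ∀ r ∈ g.rules, r.output.length ≤ M)
    (hR : ∀ r ∈ g.rules, IsProductive g r → R r.input →
      ∀ B, Symbol.nonterminal B ∈ r.output → R B ∧ rank B ≤ rank r.input ∧
        (¬ IsRegularRule r → rank B < rank r.input))
    {s : List (Symbol T g.NT)} {w : List T} {rs : List (ContextFreeRule T g.NT)}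
    (h : Yields g s w rs) {k : ℕ}
    (hs : ∀ B, Symbol.nonterminal B ∈ s → R B ∧ rank B < k) {p : List T}
    {q : List (Symbol T g.NT)} (hpq : s = p.map Symbol.terminal ++ q) {x y : List T}
    (hxy : w = x ++ y) :
    ∃ t : List (Symbol T g.NT), g.Derives s (x.map Symbol.terminal ++ t) ∧
      g.Derives t (y.map Symbol.terminal) ∧ t.length ≤ max s.length (q.length + M * k) := by
  induction h generalizing k p q x y with
  | nil =>
    obtain ⟨rfl, rfl⟩ := List.append_eq_nil_iff.mp hxy.symm
    exact ⟨[], .refl _, .refl _, by simp⟩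
  | @terminal c s w rs h ih =>
    cases x with
    | nil =>
      obtain rfl : _ = y := hxy
      exact ⟨_, .refl _, (Yields.terminal c h).derives, le_max_left _ _⟩
    | cons d x =>
      obtain ⟨rfl, rfl⟩ := List.cons_eq_cons.mp hxy
      have hs' : ∀ B, Symbol.nonterminal B ∈ s → R B ∧ rank B < k :=
        fun B hB => hs B (List.mem_cons_of_mem _ hB)
      obtain ⟨p', q', hpq', hle⟩ : ∃ (p' : List T) (q' : List (Symbol T g.NT)),
          s = p'.map Symbol.terminal ++ q' ∧ q'.length ≤ q.length := by
        cases p with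
        | nil =>
          obtain rfl : _ = q := hpq
          exact ⟨[], s, rfl, by simp⟩
        | cons e p => exact ⟨p, q, (List.cons_eq_cons.mp hpq).2, le_rfl⟩
      obtain ⟨t, ht, ht', hlen⟩ := ih hs' hpq' rfl
      refine ⟨t, ?_, ht', hlen.trans (max_le_max (by simp) (by omega))⟩
      simpa using ht.append_left [Symbol.terminal c]
  | @rule s u v rs ss r hr hu hv ihu ihv =>
    obtain rfl : p = [] := by
      cases p with
      | nil => rfl
      | cons e p => simp at hpq
    obtain rfl : _ = q := hpq
    have hstep : g.Derives (Symbol.nonterminal r.input :: s) (r.output ++ s) :=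
      ContextFreeGrammar.Produces.single ⟨r, hr, .head s⟩
    have hk := hs r.input List.mem_cons_self
    rcases List.append_eq_append_iff.mp hxy with ⟨x', rfl, rfl⟩ | ⟨y', rfl, rfl⟩
    · obtain ⟨t, ht, ht', hlen⟩ := ihv (fun B hB => hs B (List.mem_cons_of_mem _ hB))
        (p := []) rfl rfl
      refine ⟨t, ?_, ht', hlen.trans ?_⟩
      · refine hstep.trans ((hu.derives.append_right s).trans ?_)
        simpa using ht.append_left (u.map Symbol.terminal)
      · simp only [List.length_cons]
        omega
    · have hprod := hR r hr ⟨_, _, hu⟩ hk.1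
      obtain ⟨t, ht, ht', hlen⟩ : ∃ t : List (Symbol T g.NT),
          g.Derives r.output (x.map Symbol.terminal ++ t) ∧
          g.Derives t (y'.map Symbol.terminal) ∧ t.length ≤ 1 + M * k := by
        have hout := hM r hr
        have hMk : M * 1 ≤ M * k := Nat.mul_le_mul_left M (by omega)
        by_cases hreg : IsRegularRule r
        · have hs' : ∀ B, Symbol.nonterminal B ∈ r.output → R B ∧ rank B < k :=
            fun B hB => ⟨(hprod B hB).1, (hprod B hB).2.1.trans_lt hk.2⟩
          obtain ⟨p', q', hpq', hq'⟩ : ∃ (p' : List T) (q' : List (Symbol T g.NT)),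
              r.output = p'.map Symbol.terminal ++ q' ∧ q'.length ≤ 1 := by
            rcases hreg with ⟨w, hw⟩ | ⟨w, B, hw⟩
            · exact ⟨w, [], by simpa using hw, by simp⟩
            · exact ⟨w, _, hw, by simp⟩
          obtain ⟨t, ht, ht', hlen⟩ := ihu hs' hpq' rfl
          exact ⟨t, ht, ht', hlen.trans (max_le (by omega) (by omega))⟩
        · obtain ⟨t, ht, ht', hlen⟩ := ihu (k := k - 1)
            (fun B hB => ⟨(hprod B hB).1, by have := (hprod B hB).2.2 hreg; omega⟩)
            (p := []) (q := r.output) rfl rfl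
          obtain ⟨l, rfl⟩ : ∃ l, k = l + 1 := ⟨k - 1, by omega⟩
          rw [Nat.add_sub_cancel] at hlen
          rw [Nat.mul_succ M l] at hMk ⊢
          exact ⟨t, ht, ht', hlen.trans (max_le (by omega) (by omega))⟩
      refine ⟨t ++ s, ?_, ?_, ?_⟩
      · refine hstep.trans ?_
        simpa using ht.append_right s
      · simpa using (ht'.append_right s).trans (hv.derives.append_left _)
      · simp only [List.length_append, List.length_cons]
        omega

/-- A language is regular if every split of its words is witnessed by a remainder of bounded
length. -/
theorem isRegular_of_bounded_remainder {n : ℕ}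
    (h : ∀ x y : List T, x ++ y ∈ g.language → ∃ t : List (Symbol T g.NT),
      g.Derives [Symbol.nonterminal g.initial] (x.map Symbol.terminal ++ t) ∧
      g.Derives t (y.map Symbol.terminal) ∧ t.length ≤ n) :
    g.language.IsRegular := by
  refine Language.IsRegular.of_finite_range_leftQuotient ?_
  have hfin := (g.finite_symbols.lists_length_le n).finite_subsets
  refine (hfin.image fun F => {y : List T | ∃ t ∈ F, g.Derives t (y.map Symbol.terminal)}).subset
    ?_
  rintro _ ⟨x, rfl⟩
  refine ⟨{t | g.Derives [Symbol.nonterminal g.initial] (x.map Symbol.terminal ++ t) ∧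
    t.length ≤ n}, ?_, ?_⟩
  · rintro t ⟨ht, hlen⟩
    exact ⟨hlen, fun z hz => ht.mem_symbols z (List.mem_append_right _ hz)⟩
  · ext y
    constructor
    · rintro ⟨t, ⟨ht, -⟩, hty⟩
      change g.Derives _ _
      simpa using ht.trans (hty.append_left _)
    · intro hy
      obtain ⟨t, ht, hty, hlen⟩ := h x y hy
      exact ⟨t, ⟨ht, hlen⟩, hty⟩

open Classical in
/-- The number of productive non-regular rules reachable from a nonterminal. -/
noncomputable def nonregRank (g : ContextFreeGrammar T) (A : g.NT) : ℕ :=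
  (g.rules.filter fun r => ¬ IsRegularRule r ∧ IsProductive g r ∧
    Relation.ReflTransGen (UsefulEdge g) A r.input).card

theorem isRegular_of_no_loop
    (h : ∀ r ∈ g.rules, ¬ IsRegularRule r → IsProductive g r →
      Relation.ReflTransGen (UsefulEdge g) g.initial r.input →
      ∀ B, Symbol.nonterminal B ∈ r.output →
        ¬ Relation.ReflTransGen (UsefulEdge g) B r.input) :
    g.language.IsRegular := by
  have hM : ∀ r ∈ g.rules, r.output.length ≤ g.rules.sup fun r => r.output.length :=
    fun r hr => Finset.le_sup (f := fun r : ContextFreeRule T g.NT => r.output.length) hr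
  refine isRegular_of_bounded_remainder (n := max 1 (1 +
    (g.rules.sup fun r => r.output.length) * (nonregRank g g.initial + 1))) fun x y hxy => ?_
  obtain ⟨k, hk⟩ := DerivesN.exists_of_derives hxy
  obtain ⟨rs, hrs, -⟩ := hk.exists_yields rfl
  refine hrs.exists_remainder (R := Relation.ReflTransGen (UsefulEdge g) g.initial)
    (rank := nonregRank g) hM ?_ (k := nonregRank g g.initial + 1) ?_ (p := []) rfl rfl
  · intro r hr hp hreach B hB
    have hedge : UsefulEdge g r.input B := ⟨r, hr, hp, rfl, hB⟩
    refine ⟨hreach.tail hedge, Finset.card_le_card ?_, fun hreg => Finset.card_lt_card ?_⟩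
    · intro r'
      simp only [Finset.mem_filter]
      exact fun ⟨h₁, h₂, h₃, h₄⟩ => ⟨h₁, h₂, h₃, h₄.head hedge⟩
    · rw [Finset.ssubset_iff_of_subset]
      · refine ⟨r, ?_, ?_⟩
        · simpa only [Finset.mem_filter] using ⟨hr, hreg, hp, .refl⟩
        · simp only [Finset.mem_filter]
          exact fun h' => h r hr hreg hp hreach B hB h'.2.2.2
      · intro r'
        simp only [Finset.mem_filter]
        exact fun ⟨h₁, h₂, h₃, h₄⟩ => ⟨h₁, h₂, h₃, h₄.head hedge⟩
  · intro B hB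
    obtain rfl : B = g.initial := by simpa using hB
    exact ⟨.refl, Nat.lt_succ_self _⟩

end GrammarDerivations

/-- An unambiguous context-free grammar generating a non-regular language has degree of
non-regularity in `Ω(n)`. -/
theorem unambiguous_nonregular_dnreg_omega_linear (T : Type) (g : ContextFreeGrammar T)
    (hu : Unambiguous g) (hnr : ¬ g.language.IsRegular) :
    InOmegaLinear (dnregFun g) := by
  by_contra h
  refine hnr (isRegular_of_no_loop fun r hr hreg hp hreach B hB hloop => h ?_)
  exact hu.inOmegaLinear_of_loop hr hreg hp hreach hB hloop
end

section
/- It is undecidable, given a linear context-free grammar G, whether dnreg_G(n) ∈ O(1), i.e., whether the degree of non-regularity of G is bounded by a constant. -/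
/-- A linear rule `A → u B v` or `A → u` over terminal alphabet `Bool`, with nonterminals
indexed by `ℕ`: the data `(A, u, none)` encodes `A → u` and `(A, u, some (B, v))` encodes
`A → u B v`. Every linear context-free grammar (over a two-letter alphabet) is represented by
a list of such rules, with initial nonterminal `0`. -/
abbrev LinRule : Type := ℕ × List Bool × Option (ℕ × List Bool)

/-- The context-free rule encoded by a `LinRule`. -/
def LinRule.toRule (r : LinRule) : ContextFreeRule Bool ℕ :=
  ⟨r.1, r.2.1.map Symbol.terminal ++
    (match r.2.2 with
      | none => []
      | some (B, v) => Symbol.nonterminal B :: v.map Symbol.terminal)⟩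

/-- The linear context-free grammar encoded by a list of linear rules (initial nonterminal `0`). -/
noncomputable def linCFG (rs : List LinRule) : ContextFreeGrammar Bool :=
  letI : DecidableEq (ContextFreeRule Bool ℕ) := Classical.decEq _
  ⟨ℕ, 0, (rs.map LinRule.toRule).toFinset⟩

namespace LinGrammar

/-- `Gen rs A w k`: the nonterminal `A` derives the terminal word `w` in the linear grammar with
rules `rs`, using exactly `k` rules with a nonempty right part. -/
inductive Gen (rs : List LinRule) : ℕ → List Bool → ℕ → Prop
  | leaf {A : ℕ} {u : List Bool} (h : (A, u, none) ∈ rs) : Gen rs A u 0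
  | reg {A B : ℕ} {u w : List Bool} {k : ℕ} (h : (A, u, some (B, [])) ∈ rs)
      (hw : Gen rs B w k) : Gen rs A (u ++ w) k
  | nonreg {A B : ℕ} {u v w : List Bool} {k : ℕ} (h : (A, u, some (B, v)) ∈ rs) (hv : v ≠ [])
      (hw : Gen rs B w k) : Gen rs A (u ++ w ++ v) (k + 1)

theorem isRegularRule_toRule_none (A : ℕ) (u : List Bool) :
    IsRegularRule (LinRule.toRule (A, u, none)) :=
  Or.inl ⟨u, by simp [LinRule.toRule]⟩

theorem isRegularRule_toRule_some_nil (A B : ℕ) (u : List Bool) :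
    IsRegularRule (LinRule.toRule (A, u, some (B, []))) :=
  Or.inr ⟨u, B, by simp [LinRule.toRule]⟩

theorem nonterminal_notMem_map_terminal {N : Type} (A : N) (w : List Bool) :
    Symbol.nonterminal A ∉ w.map (Symbol.terminal (N := N)) := by
  simp

theorem map_terminal_append_nonterminal_inj {N : Type} {A B : N} {p s p' s' : List (Symbol Bool N)}
    (hp : Symbol.nonterminal A ∉ p) (hs : Symbol.nonterminal A ∉ s)
    (h : p' ++ [Symbol.nonterminal A] ++ s' = p ++ Symbol.nonterminal B :: s) :
    A = B ∧ p' = p ∧ s' = s := by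
  have hA : A = B := by
    have : Symbol.nonterminal A ∈ p ++ Symbol.nonterminal B :: s := by rw [← h]; simp
    simpa [hp, hs] using this
  subst hA
  refine ⟨rfl, ?_⟩
  rw [List.append_assoc] at h
  rcases List.append_eq_append_iff.1 h with ⟨a, ha, hb⟩ | ⟨a, ha, hb⟩
  · cases a with
    | nil => simpa using And.intro ha.symm hb
    | cons x a =>
      obtain ⟨rfl, -⟩ : Symbol.nonterminal A = x ∧ _ := by simpa using hb
      exact absurd (by rw [ha]; simp) hp
  · cases a with
    | nil => simpa using And.intro ha hb.symm
    | cons x a =>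
      simp only [List.cons_append, List.cons.injEq] at hb
      exact absurd (by rw [hb.2]; simp) hs

theorem not_isRegularRule_toRule (A B : ℕ) (u v : List Bool) (hv : v ≠ []) :
    ¬ IsRegularRule (LinRule.toRule (A, u, some (B, v))) := by
  rintro (⟨w, hw⟩ | ⟨w, C, hw⟩)
  · refine nonterminal_notMem_map_terminal B w ?_
    rw [← hw]; simp [LinRule.toRule]
  · have := map_terminal_append_nonterminal_inj (A := B) (B := C) (p := w.map Symbol.terminal)
      (s := []) (p' := u.map Symbol.terminal) (s' := v.map Symbol.terminal) (by simp) (by simp)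
      (by simpa [LinRule.toRule] using hw)
    simp_all

theorem mem_rules_linCFG {rs : List LinRule} {r : ContextFreeRule Bool ℕ} :
    r ∈ (linCFG rs).rules ↔ ∃ r₀ ∈ rs, LinRule.toRule r₀ = r := by
  let : DecidableEq (ContextFreeRule Bool ℕ) := Classical.decEq _
  change r ∈ (rs.map LinRule.toRule).toFinset ↔ _
  rw [List.mem_toFinset, List.mem_map]

theorem eq_of_derivesN_terminal {rs : List LinRule} {k : ℕ}
    {u v : List (Symbol Bool (linCFG rs).NT)} (h : DerivesN (linCFG rs) u v k) (p : List Bool) (hp : u = p.map Symbol.terminal) :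
    u = v ∧ k = 0 := by
  cases h with
  | refl => exact ⟨rfl, rfl⟩
  | regStep r hr hreg huv hvw | nonregStep r hr hreg huv hvw =>
    have := huv.nonterminal_input_mem
    rw [hp] at this
    exact absurd this (nonterminal_notMem_map_terminal _ _)

theorem rewrites_toRule {r : LinRule} {A : ℕ} {p s : List Bool} {u v : List (Symbol Bool ℕ)}
    (hu : u = p.map Symbol.terminal ++ Symbol.nonterminal A :: s.map Symbol.terminal)
    (h : r.toRule.Rewrites u v) :
    A = r.1 ∧
      v = p.map Symbol.terminal ++ r.toRule.output ++ s.map Symbol.terminal := by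
  obtain ⟨p', s', h₁, h₂⟩ := h.exists_parts
  obtain ⟨h₃, rfl, rfl⟩ := map_terminal_append_nonterminal_inj (by simp) (by simp)
    (h₁.symm.trans hu)
  exact ⟨h₃.symm, h₂⟩

theorem append_output_none (A : ℕ) (p x s : List Bool) :
    p.map Symbol.terminal ++ (LinRule.toRule (A, x, none)).output ++ s.map Symbol.terminal =
      (p ++ x ++ s).map Symbol.terminal := by
  simp [LinRule.toRule]

theorem append_output_some (A B : ℕ) (p x y s : List Bool) :
    p.map Symbol.terminal ++ (LinRule.toRule (A, x, some (B, y))).output ++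
        s.map Symbol.terminal =
      (p ++ x).map Symbol.terminal ++ Symbol.nonterminal B :: (y ++ s).map Symbol.terminal := by
  simp [LinRule.toRule]

theorem gen_of_derivesN {rs : List LinRule} {k : ℕ}
    {u v : List (Symbol Bool (linCFG rs).NT)} (h : DerivesN (linCFG rs) u v k) (p s w : List Bool) (A : ℕ)
    (hu : u = p.map Symbol.terminal ++ Symbol.nonterminal A :: s.map Symbol.terminal)
    (hv : v = w.map Symbol.terminal) : ∃ x, Gen rs A x k ∧ w = p ++ x ++ s := by
  have inj : Function.Injective (List.map (Symbol.terminal (T := Bool) (N := ℕ))) :=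
    List.map_injective_iff.2 fun _ _ h => by simpa using h
  induction h generalizing p s A with
  | refl u =>
    have h : w.map (Symbol.terminal (N := ℕ)) =
        p.map Symbol.terminal ++ Symbol.nonterminal A :: s.map Symbol.terminal := hv.symm.trans hu
    refine absurd ?_ (nonterminal_notMem_map_terminal A w)
    rw [h]; simp
  | @regStep u v' w' k r hr hreg huv hvw ih =>
    obtain ⟨⟨A', x, o⟩, hr₀, rfl⟩ := mem_rules_linCFG.1 hr
    obtain ⟨rfl, hv'⟩ := rewrites_toRule hu huv
    match o with
    | none =>
      have hv'' := hv'.trans (append_output_none A p x s)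
      obtain ⟨h₁, rfl⟩ := eq_of_derivesN_terminal hvw _ hv''
      exact ⟨x, .leaf hr₀, inj (hv.symm.trans (h₁.symm.trans hv''))⟩
    | some (B, []) =>
      obtain ⟨y, hy, rfl⟩ := ih (p ++ x) s B (hv'.trans (append_output_some A B p x [] s)) hv
      exact ⟨x ++ y, .reg hr₀ hy, by simp⟩
    | some (B, b :: y) => exact absurd hreg (not_isRegularRule_toRule _ _ _ _ (by simp))
  | @nonregStep u v' w' k r hr hreg huv hvw ih =>
    obtain ⟨⟨A', x, o⟩, hr₀, rfl⟩ := mem_rules_linCFG.1 hr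
    obtain ⟨rfl, hv'⟩ := rewrites_toRule hu huv
    match o with
    | none => exact absurd (isRegularRule_toRule_none _ _) hreg
    | some (B, []) => exact absurd (isRegularRule_toRule_some_nil _ _ _) hreg
    | some (B, b :: z) =>
      obtain ⟨y, hy, rfl⟩ := ih (p ++ x) (b :: z ++ s) B (hv'.trans (append_output_some A B p x (b :: z) s)) hv
      exact ⟨x ++ y ++ b :: z, .nonreg hr₀ (by simp) hy, by simp⟩

theorem rewrites_of_toRule (r : LinRule) (p s : List (Symbol Bool ℕ)) :
    r.toRule.Rewrites (p ++ Symbol.nonterminal r.1 :: s) (p ++ r.toRule.output ++ s) := by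
  simpa [LinRule.toRule] using r.toRule.rewrites_of_exists_parts p s

theorem Gen.derivesN {rs : List LinRule} {A k : ℕ} {x : List Bool} (h : Gen rs A x k)
    (p s : List Bool) (u v : List (Symbol Bool (linCFG rs).NT))
    (hu : u = p.map Symbol.terminal ++ Symbol.nonterminal (N := ℕ) A :: s.map Symbol.terminal)
    (hv : v = (p ++ x ++ s).map Symbol.terminal) : DerivesN (linCFG rs) u v k := by
  induction h generalizing p s u with
  | @leaf A x h =>
    subst hu
    refine .regStep _ (mem_rules_linCFG.2 ⟨_, h, rfl⟩) (isRegularRule_toRule_none _ _)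
      (rewrites_of_toRule (A, x, none) _ _) ?_
    rw [hv, List.map_append, List.map_append]
    simp only [LinRule.toRule, List.append_nil]
    exact DerivesN.refl _
  | @reg A B x w k h _ ih =>
    subst hu
    refine .regStep _ (mem_rules_linCFG.2 ⟨_, h, rfl⟩) (isRegularRule_toRule_some_nil _ _ _)
      (rewrites_of_toRule (A, x, some (B, [])) _ _) (ih (p ++ x) s _ (append_output_some A B p x [] s) ?_)
    simp [hv]
  | @nonreg A B x y w k h hy _ ih =>
    subst hu
    refine .nonregStep _ (mem_rules_linCFG.2 ⟨_, h, rfl⟩) (not_isRegularRule_toRule _ _ _ _ hy)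
      (rewrites_of_toRule (A, x, some (B, y)) _ _) (ih (p ++ x) (y ++ s) _ (append_output_some A B p x y s) ?_)
    simp [hv]

theorem derivesN_iff_gen {rs : List LinRule} {w : List Bool} {k : ℕ} :
    DerivesN (linCFG rs) [Symbol.nonterminal (linCFG rs).initial] (w.map Symbol.terminal) k ↔
      Gen rs 0 w k := by
  refine ⟨fun h => ?_, fun h => h.derivesN [] [] _ _ rfl (by simp)⟩
  obtain ⟨x, hx, rfl⟩ := gen_of_derivesN h [] [] w 0 rfl rfl
  simpa using hx

theorem dnregWord_linCFG (rs : List LinRule) (w : List Bool) :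
    dnregWord (linCFG rs) w = sInf {k | Gen rs 0 w k} := by
  simp only [dnregWord, derivesN_iff_gen]

theorem dnregFun_bounded_iff (rs : List LinRule) :
    (∃ c, ∀ n, dnregFun (linCFG rs) n ≤ c) ↔
      ∃ c, ∀ w k, Gen rs 0 w k → ∃ k' ≤ c, Gen rs 0 w k' := by
  refine exists_congr fun c => ⟨fun h w k hk => ?_, fun h n => ?_⟩
  · have hfin : {m | ∃ w' : List Bool, w'.length = w.length ∧
        dnregWord (linCFG rs) w' = m}.Finite :=
      (List.finite_length_eq Bool w.length).image _
    refine ⟨dnregWord (linCFG rs) w, (le_csSup hfin.bddAbove ⟨w, rfl, rfl⟩).trans (h w.length), ?_⟩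
    rw [dnregWord_linCFG]
    exact Nat.sInf_mem (s := {k | Gen rs 0 w k}) ⟨k, hk⟩
  · refine csSup_le' ?_
    rintro _ ⟨w, -, rfl⟩
    rw [dnregWord_linCFG]
    by_cases hw : ∃ k, Gen rs 0 w k
    · obtain ⟨k, hk⟩ := hw
      obtain ⟨k', hk', hg⟩ := h w k hk
      exact (Nat.sInf_le hg).trans hk'
    · rw [show {k | Gen rs 0 w k} = ∅ from
        Set.eq_empty_of_forall_notMem fun k hk => hw ⟨k, hk⟩]
      simp

/-- One step of a queue automaton with transition function `δ`: the first letter of the queue is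
removed and a word is appended at the end. -/
def queueStep {Q A : Type} (δ : Q → A → Option (Q × List A)) : Q × List A → Option (Q × List A)
  | (_, []) => none
  | (q, a :: l) => (δ q a).map fun x => (x.1, l ++ x.2)

/-- `Emits δ q y o`: starting in state `q`, the queue automaton can read the letters of `y`, and
appends the word `o` to its queue when doing so. -/
inductive Emits {Q A : Type} (δ : Q → A → Option (Q × List A)) : Q → List A → List A → Prop
  | nil (q : Q) : Emits δ q [] []
  | cons {q q' : Q} {b : A} {u y o : List A} (h : δ q b = some (q', u)) (hy : Emits δ q' y o) :
      Emits δ q (b :: y) (u ++ o)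

theorem exists_emits_of_not_dom {Q A : Type} {δ : Q → A → Option (Q × List A)} (p : ℕ) (q : Q)
    (l : List A) (h : ¬ (StateTransition.eval (queueStep δ) (q, l)).Dom) :
    ∃ y o, y.length = p ∧ Emits δ q y o ∧ y <+: l ++ o := by
  induction p generalizing q l with
  | zero => exact ⟨[], [], rfl, .nil q, List.nil_prefix⟩
  | succ p ih =>
    rcases hs : queueStep δ (q, l) with _ | ⟨q', l'⟩
    · exact absurd (Part.dom_iff_mem.2
        ⟨_, StateTransition.mem_eval.2 ⟨Relation.ReflTransGen.refl, hs⟩⟩) h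
    · rw [StateTransition.reaches_eval (Relation.ReflTransGen.single hs)] at h
      obtain ⟨y, o, hy, he, hpre⟩ := ih q' l' h
      cases l with
      | nil => simp [queueStep] at hs
      | cons a l =>
        obtain ⟨⟨q'', u⟩, hδ, heq⟩ := Option.map_eq_some_iff.1 hs
        simp only [Prod.mk.injEq] at heq
        obtain ⟨rfl, rfl⟩ := heq
        refine ⟨a :: y, u ++ o, by simp [hy], .cons hδ he, ?_⟩
        simpa using hpre

/-- The shortest words that are not comparable with the given word in the prefix order. -/
def deviations : List Bool → List (List Bool)
  | [] => []
  | b :: l => [!b] :: (deviations l).map (b :: ·)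

theorem append_ne_of_mem_deviations {u m : List Bool} (hm : m ∈ deviations u) (a b : List Bool) :
    m ++ a ≠ u ++ b := by
  induction u generalizing m with
  | nil => simp [deviations] at hm
  | cons c u ih =>
    simp only [deviations, List.mem_cons, List.mem_map] at hm
    rcases hm with rfl | ⟨m, hm, rfl⟩
    · cases c <;> simp
    · simpa using ih hm

theorem eq_append_or_deviation (u w : List Bool) (h : u.length ≤ w.length) :
    (∃ z, w = u ++ z) ∨ ∃ m ∈ deviations u, ∃ z, w = m ++ z := by
  induction u generalizing w with
  | nil => exact Or.inl ⟨w, rfl⟩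
  | cons c u ih =>
    cases w with
    | nil => simp at h
    | cons d w =>
      by_cases hd : d = c
      · subst hd
        rcases ih w (by simpa using h) with ⟨z, rfl⟩ | ⟨m, hm, z, rfl⟩
        · exact Or.inl ⟨z, rfl⟩
        · exact Or.inr ⟨d :: m, by simp [deviations, hm], z, rfl⟩
      · refine Or.inr ⟨[!c], by simp [deviations], w, ?_⟩
        cases c <;> cases d <;> simp_all

/-- Rules generating the words that are not palindromes (nonterminal `1`) and all words
(nonterminal `2`). -/
def baseRules : List LinRule :=
  (0, [], some (1, [])) :: (2, [], none) ::
    [true, false].flatMap fun b =>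
      [(1, [b], some (1, [b])), (1, [b], some (2, [!b])), (2, [b], some (2, []))]

variable {Q : Type}

/-- Rules for the state `q` of a queue automaton reading the letter `b`. The right part of a
sentential form is the sequence of letters read, the left part is the sequence of letters
written, up to the first error. -/
def stateRules (δ : Q → Bool → Option (Q × List Bool)) (ι : Q → ℕ) (q : Q) (b : Bool) :
    List LinRule :=
  match δ q b with
  | none => [(ι q + 3, [], some (2, [b]))]
  | some (q', u) => (ι q + 3, u, some (ι q' + 3, [b])) ::
      (deviations u).map fun m => (ι q + 3, m, some (2, [b]))

/-- Rules for the initial queue `l` and the initial state with number `i`. -/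
def startRules (i : ℕ) (l : List Bool) : List LinRule :=
  (0, l, some (i + 3, [])) :: (deviations l).map fun m => (0, m, some (2, []))

/-- The part of the grammar of a queue automaton that does not depend on the initial queue. -/
noncomputable def machineRules (δ : Q → Bool → Option (Q × List Bool)) (ι : Q → ℕ)
    (F : Finset Q) : List LinRule :=
  baseRules ++ F.toList.flatMap fun q => [true, false].flatMap (stateRules δ ι q)

theorem mem_stateRules {δ : Q → Bool → Option (Q × List Bool)} {ι : Q → ℕ} {q : Q} {b : Bool}
    {r : LinRule} : r ∈ stateRules δ ι q b ↔
      (δ q b = none ∧ r = (ι q + 3, [], some (2, [b]))) ∨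
      ∃ q' u, δ q b = some (q', u) ∧ (r = (ι q + 3, u, some (ι q' + 3, [b])) ∨
        ∃ m ∈ deviations u, r = (ι q + 3, m, some (2, [b]))) := by
  unfold stateRules
  rcases δ q b with _ | ⟨q', u⟩ <;> simp [eq_comm]

theorem mem_grammar {δ : Q → Bool → Option (Q × List Bool)} {ι : Q → ℕ} {F : Finset Q} {i : ℕ}
    {l : List Bool} {r : LinRule} : r ∈ machineRules δ ι F ++ startRules i l ↔
      r ∈ baseRules ∨ (∃ q ∈ F, ∃ b, r ∈ stateRules δ ι q b) ∨ r ∈ startRules i l := by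
  simp only [machineRules, List.mem_append, or_assoc, List.mem_flatMap, Finset.mem_toList,
    List.mem_cons, List.not_mem_nil, or_false, Bool.exists_bool, exists_eq_or_imp, exists_eq_left,
    or_comm (a := r ∈ stateRules δ ι _ true)]

theorem Gen.le_length {rs : List LinRule} {A k : ℕ} {w : List Bool} (h : Gen rs A w k) :
    k ≤ w.length := by
  induction h with
  | leaf => exact Nat.zero_le _
  | reg _ _ ih => simp; omega
  | nonreg _ hv _ ih => have := List.length_pos_iff.2 hv; simp; omega

section Grammar

variable {δ : Q → Bool → Option (Q × List Bool)} {ι : Q → ℕ} {F : Finset Q} {i : ℕ} {l : List Bool}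

local notation "GR" => machineRules δ ι F ++ startRules i l

theorem gen_two (w : List Bool) : Gen GR 2 w 0 := by
  induction w with
  | nil => exact .leaf (mem_grammar.2 (Or.inl (by simp [baseRules])))
  | cons b w ih =>
    exact .reg (u := [b]) (mem_grammar.2 (Or.inl (by cases b <;> simp [baseRules]))) ih

theorem gen_one_append (x : List Bool) {w : List Bool} {k : ℕ} (h : Gen GR 1 w k) :
    Gen GR 1 (x ++ w ++ x.reverse) (x.length + k) := by
  induction x with
  | nil => simpa using h
  | cons b x ih =>
    have := Gen.nonreg (u := [b]) (v := [b]) (A := 1)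
      (mem_grammar.2 (Or.inl (by cases b <;> simp [baseRules]))) (by simp) ih
    convert this using 1
    · simp
    · simp; omega

theorem gen_one_of_ne (b : Bool) (w : List Bool) : Gen GR 1 (b :: w ++ [!b]) 1 :=
  Gen.nonreg (u := [b]) (v := [!b])
    (mem_grammar.2 (Or.inl (by cases b <;> simp [baseRules]))) (by simp) (gen_two w)

theorem exists_gen_one (x y z : List Bool) (hxy : x.length = y.length) (hne : x ≠ y) :
    ∃ k ≤ x.length, Gen GR 1 (x ++ z ++ y.reverse) k := by
  induction x generalizing y with
  | nil => simp_all [eq_comm]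
  | cons a x ih =>
    cases y with
    | nil => simp at hxy
    | cons b y =>
      by_cases hab : a = b
      · subst hab
        obtain ⟨k, hk, hg⟩ := ih y (by simpa using hxy) (by simpa using hne)
        refine ⟨k + 1, by simpa using hk, ?_⟩
        simpa [Nat.add_comm] using gen_one_append [a] hg
      · obtain rfl : b = !a := by cases a <;> cases b <;> simp_all
        exact ⟨1, by simp, by simpa using gen_one_of_ne a (x ++ z ++ y.reverse)⟩

theorem gen_zero_of_gen_one {w : List Bool} {k : ℕ} (h : Gen GR 1 w k) : Gen GR 0 w k :=
  Gen.reg (u := []) (mem_grammar.2 (Or.inl (by simp [baseRules]))) h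

theorem length_le_of_gen_one (x z : List Bool) (k : ℕ) (h : Gen GR 1 (x ++ z ++ x.reverse) k) :
    x.length ≤ k := by
  have key : ∀ u o, (1, u, o) ∈ GR →
      ∃ b : Bool, u = [b] ∧ (o = some (1, [b]) ∨ o = some (2, [!b])) := by
    intro u o hm
    rcases mem_grammar.1 hm with h | ⟨q, -, b, h⟩ | h
    · simp [baseRules] at h
      grind
    · simp [mem_stateRules] at h
    · simp [startRules] at h
  induction x generalizing k with
  | nil => simp
  | cons a x ih =>
    generalize hw : a :: x ++ z ++ (a :: x).reverse = w at h
    cases h with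
    | leaf hm => obtain ⟨b, rfl, h | h⟩ := key _ _ hm <;> cases h
    | reg hm hg => obtain ⟨b, rfl, h | h⟩ := key _ _ hm <;> cases h
    | @nonreg _ B u v w k hm hv hg =>
      have hw' : [a] ++ (x ++ z ++ x.reverse) ++ [a] = u ++ w ++ v := by simpa using hw
      obtain ⟨b, rfl, h | h⟩ := key _ _ hm
      · cases h
        have h₁ := List.append_inj' hw' rfl
        have h₂ := List.append_inj h₁.1 rfl
        have := ih k (h₂.2 ▸ hg)
        simpa using this
      · cases h
        have h₁ := List.append_inj' hw' rfl
        have h₂ := List.append_inj h₁.1 rfl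
        simp_all

theorem length_le_of_gen_state (hι : Set.InjOn ι F)
    (hF : ∀ q ∈ F, ∀ b q' u, δ q b = some (q', u) → q' ∈ F) {q : Q}
    {y o : List Bool} (he : Emits δ q y o) (hq : q ∈ F) (z : List Bool) (k : ℕ)
    (h : Gen GR (ι q + 3) (o ++ z ++ y.reverse) k) : y.length ≤ k := by
  induction he generalizing k with
  | nil => simp
  | @cons q q' b u y o hδ hy ih =>
    have key : ∀ x s, (ι q + 3, x, s) ∈ GR → ∃ c, (x, s) ∈ (stateRules δ ι q c).map Prod.snd := by
      intro x s hm
      rcases mem_grammar.1 hm with h | ⟨q₁, hq₁, c, h⟩ | h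
      · simp [baseRules] at h
      · obtain rfl : q = q₁ := by
          refine hι hq hq₁ ?_
          simp [mem_stateRules] at h
          grind
        exact ⟨c, List.mem_map.2 ⟨_, h, rfl⟩⟩
      · simp [startRules] at h
    generalize hw : u ++ o ++ z ++ (b :: y).reverse = w at h
    cases h with
    | leaf hm =>
      obtain ⟨c, h⟩ := key _ _ hm
      simp [mem_stateRules] at h
    | reg hm hg =>
      obtain ⟨c, h⟩ := key _ _ hm
      simp [mem_stateRules] at h
    | @nonreg _ B x v w k hm hv hg =>
      obtain ⟨c, h⟩ := key _ _ hm
      have hw' : u ++ (o ++ z ++ y.reverse) ++ [b] = x ++ w ++ v := by simpa using hw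
      have hvc : v = [c] := by
        simp [mem_stateRules] at h
        grind
      subst hvc
      obtain ⟨h₁, h₂⟩ := List.append_inj' hw' rfl
      obtain rfl : b = c := by simpa using h₂
      simp only [List.mem_map, mem_stateRules, hδ] at h
      obtain ⟨r, h | ⟨q₂, u₂, h, h'⟩, hr⟩ := h
      · cases h.1
      · cases h
        rcases h' with rfl | ⟨m, hm', rfl⟩
        · cases hr
          obtain ⟨-, h₃⟩ := List.append_inj h₁ rfl
          have := ih (hF _ hq _ _ _ hδ) k (h₃ ▸ hg)
          simpa using this
        · cases hr
          exact absurd h₁.symm (append_ne_of_mem_deviations hm' _ _)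

theorem exists_gen_state (hF : ∀ q ∈ F, ∀ b q' u, δ q b = some (q', u) → q' ∈ F)
    {c c' : Q × List Bool} (hr : StateTransition.Reaches (queueStep δ) c c') (hc : c.1 ∈ F)
    {a : Bool} {l' : List Bool} (hc' : c'.2 = a :: l') (hδ : δ c'.1 a = none) :
    ∃ p m, ∀ y z w : List Bool, y.length = p → m ≤ w.length → y ++ z = c.2 ++ w →
      ∃ k ≤ p, Gen GR (ι c.1 + 3) (w ++ y.reverse) k := by
  induction hr using Relation.ReflTransGen.head_induction_on with
  | refl =>
    refine ⟨1, 0, fun y z w hy _ hyz => ⟨1, le_rfl, ?_⟩⟩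
    obtain ⟨b, rfl⟩ := List.length_eq_one_iff.1 hy
    obtain rfl : b = a := by rw [hc'] at hyz; simp at hyz; exact hyz.1
    refine Gen.nonreg (u := []) (v := [b]) (B := 2) ?_ (by simp) (gen_two w)
    exact mem_grammar.2 (Or.inr (Or.inl ⟨_, hc, b, mem_stateRules.2 (Or.inl ⟨hδ, rfl⟩)⟩))
  | @head c d hcd hd ih =>
    obtain ⟨q, l₁⟩ := c
    cases l₁ with
    | nil => simp [queueStep] at hcd
    | cons a₁ l₁ =>
      obtain ⟨⟨q', u⟩, hδ', rfl⟩ := Option.map_eq_some_iff.1 hcd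
      obtain ⟨p, m, H⟩ := ih (hF _ hc _ _ _ hδ')
      refine ⟨p + 1, u.length + m, fun y z w hy hw hyz => ?_⟩
      cases y with
      | nil => simp at hy
      | cons b y =>
        simp only [List.cons_append, List.cons.injEq] at hyz
        obtain ⟨rfl, hyz⟩ := hyz
        rcases eq_append_or_deviation u w (by omega) with ⟨w, rfl⟩ | ⟨x, hx, w, rfl⟩
        · obtain ⟨k, hk, hg⟩ := H y z w (by simpa using hy) (by simpa using hw)
            (by simpa using hyz)
          refine ⟨k + 1, by omega, ?_⟩
          have := Gen.nonreg (u := u) (v := [b]) (A := ι q + 3) (mem_grammar.2 (Or.inr (Or.inl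
            ⟨_, hc, b, mem_stateRules.2 (Or.inr ⟨_, _, hδ', Or.inl rfl⟩)⟩))) (by simp) hg
          simpa using this
        · refine ⟨1, by omega, ?_⟩
          have := Gen.nonreg (u := x) (v := [b]) (A := ι q + 3) (mem_grammar.2 (Or.inr (Or.inl
            ⟨_, hc, b, mem_stateRules.2 (Or.inr ⟨_, _, hδ', Or.inr ⟨x, hx, rfl⟩⟩)⟩))) (by simp)
            (gen_two (i := i) (l := l) (w ++ y.reverse))
          simpa using this

end Grammar

/-- The grammar of a queue automaton has bounded degree of non-regularity if and only if the
automaton halts. -/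
theorem bounded_iff_halts {δ : Q → Bool → Option (Q × List Bool)} {ι : Q → ℕ} {F : Finset Q}
    (hι : Set.InjOn ι F) (hF : ∀ q ∈ F, ∀ b q' u, δ q b = some (q', u) → q' ∈ F) {q₀ : Q}
    (hq₀ : q₀ ∈ F) (l : List Bool)
    (hne : ∀ c ∈ StateTransition.eval (queueStep δ) (q₀, l), c.2 ≠ []) :
    (∃ c, ∀ w k, Gen (machineRules δ ι F ++ startRules (ι q₀) l) 0 w k →
      ∃ k' ≤ c, Gen (machineRules δ ι F ++ startRules (ι q₀) l) 0 w k') ↔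
    (StateTransition.eval (queueStep δ) (q₀, l)).Dom := by
  constructor
  · rintro ⟨c, hc⟩
    by_contra hdom
    obtain ⟨y, o, hy, he, t, ht⟩ := exists_emits_of_not_dom (c + 1) q₀ l hdom
    have hpal := gen_one_append (δ := δ) (ι := ι) (F := F) (i := ι q₀) (l := l) (l ++ o)
      (gen_one_of_ne true [])
    obtain ⟨k, hk, hg⟩ := hc _ _ (gen_zero_of_gen_one hpal)
    have key : ∀ u s, (0, u, s) ∈ machineRules δ ι F ++ startRules (ι q₀) l →
        (u, s) = ([], some (1, [])) ∨ (u, s) = (l, some (ι q₀ + 3, [])) ∨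
          u ∈ deviations l ∧ s = some (2, []) := by
      intro u s hm
      rcases mem_grammar.1 hm with h | ⟨q, -, b, h⟩ | h
      · simp [baseRules] at h; simp [h]
      · simp [mem_stateRules] at h
      · simp [startRules] at h; grind
    generalize hw : l ++ o ++ (true :: [] ++ [!true]) ++ (l ++ o).reverse = w at hg
    have hlen : c + 1 ≤ (l ++ o).length := by rw [← hy, ← ht]; simp
    suffices c + 1 ≤ k by omega
    cases hg with
    | leaf hm => rcases key _ _ hm with h | h | h <;> simp at h
    | nonreg hm hv => rcases key _ _ hm with h | h | h <;> simp at h <;> simp_all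
    | @reg _ B u w k hm hg =>
      rcases key _ _ hm with h | h | h
      · cases h
        simp only [List.nil_append] at hw
        exact hlen.trans (length_le_of_gen_one _ _ _ (hw ▸ hg))
      · cases h
        rw [← hy]
        refine length_le_of_gen_state (i := ι q₀) (l := l) hι hF he hq₀
          ([true, false] ++ t.reverse) _ ?_
        · have : w = o ++ ([true, false] ++ t.reverse) ++ y.reverse := by
            rw [← ht] at hw
            have hw : l ++ (o ++ [true, false] ++ (y ++ t).reverse) = l ++ w := by
              rw [← hw, ht]; simp
            rw [← List.append_cancel_left hw]; simp
          exact this ▸ hg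
      · refine absurd hw.symm ?_
        simp only [List.append_assoc]
        exact append_ne_of_mem_deviations h.1 _ _
  · intro hdom
    obtain ⟨⟨q, l₁⟩, hmem⟩ := Part.dom_iff_mem.1 hdom
    have hl₁ := hne _ hmem
    obtain ⟨hr, hnone⟩ := StateTransition.mem_eval.1 hmem
    obtain ⟨a, l', rfl⟩ := List.exists_cons_of_ne_nil hl₁
    obtain ⟨p, m, H⟩ := exists_gen_state (ι := ι) (i := ι q₀) (l := l) hF hr hq₀ rfl
      (Option.map_eq_none_iff.1 hnone)
    refine ⟨2 * p + m + l.length, fun w k hk => ?_⟩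
    by_cases hw : w.length ≤ 2 * p + m + l.length
    · exact ⟨k, hk.le_length.trans hw, hk⟩
    obtain ⟨y, z, v, rfl, hy, hv⟩ : ∃ y z v : List Bool, w = y ++ z ++ v.reverse ∧
        y.length = p ∧ v.length = p := by
      refine ⟨w.take p, (w.drop p).take (w.length - 2 * p), (w.drop (w.length - p)).reverse,
        ?_, by simp; omega, by simp; omega⟩
      have h₁ : w.drop (w.length - p) = (w.drop p).drop (w.length - 2 * p) := by
        rw [List.drop_drop]; congr 1; omega
      simp [h₁]
    by_cases hyv : y = v
    · subst hyv
      simp only [List.length_append, List.length_reverse] at hw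
      rcases eq_append_or_deviation l (y ++ z) (by simp; omega) with ⟨w, h⟩ | ⟨x, hx, w, h⟩
      · have hlen := congrArg List.length h
        simp only [List.length_append] at hlen
        obtain ⟨k', hk', hg⟩ := H y z w hy (by omega) h
        refine ⟨k', by omega, ?_⟩
        rw [h, List.append_assoc]
        exact .reg (mem_grammar.2 (Or.inr (Or.inr (by simp [startRules])))) hg
      · refine ⟨0, by omega, ?_⟩
        rw [h, List.append_assoc]
        exact .reg (mem_grammar.2 (Or.inr (Or.inr (by simp [startRules, hx])))) (gen_two _)
    · obtain ⟨k', hk', hg⟩ := exists_gen_one (δ := δ) (ι := ι) (F := F) (i := ι q₀) (l := l)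
        y v z (hy.trans hv.symm) hyv
      exact ⟨k', by omega, gen_zero_of_gen_one hg⟩

section StackMachine

open Turing.PartrecToTM2 (K')
open StateTransition

/-- The cyclic successor on the four stack names. -/
def nextStack : K' → K'
  | .main => .rev
  | .rev => .aux
  | .aux => .stack
  | .stack => .main

variable {Γ Λ σ : Type}

/-- The result of executing a statement of a stack machine when the first letter of the queue is
`c`, the letters up to the first separator `none` being the content of the stack `j`: the
remaining statement, the new internal state and the word appended to the queue. -/
def queueAct (M : Λ → Turing.TM2.Stmt (fun _ : K' => Γ) Λ σ) (j : K') (c : Option Γ) (v : σ) :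
    Turing.TM2.Stmt (fun _ : K' => Γ) Λ σ →
      Option (Turing.TM2.Stmt (fun _ : K' => Γ) Λ σ) × σ × List (Option Γ)
  | .push k f q => if j = k then (some q, v, [some (f v), c]) else (some (.push k f q), v, [c])
  | .peek k f q => if j = k then (some q, f v c, [c]) else (some (.peek k f q), v, [c])
  | .pop k f q =>
    if j = k then (some q, f v c, if c.isSome then [] else [c]) else (some (.pop k f q), v, [c])
  | .load a q => (some q, a v, [c])
  | .branch p q₁ q₂ => (some (cond (p v) q₁ q₂), v, [c])
  | .goto l => (some (M (l v)), v, [c])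
  | .halt => (none, v, [c])

/-- States of the queue automaton simulating a stack machine: whether the current segment of the
queue is only copied, the remaining statement, the internal state, and the name of the stack
stored in the current segment. -/
abbrev QueueState (Γ Λ σ : Type) : Type :=
  Bool × Option (Turing.TM2.Stmt (fun _ : K' => Γ) Λ σ) × σ × K'

/-- The transition function of a queue automaton simulating a stack machine. -/
def queueDelta (M : Λ → Turing.TM2.Stmt (fun _ : K' => Γ) Λ σ) :
    QueueState Γ Λ σ → Option Γ → Option (QueueState Γ Λ σ × List (Option Γ))
  | (true, s, v, j), some a => some ((true, s, v, j), [some a])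
  | (true, s, v, j), none => some ((false, s, v, nextStack j), [none])
  | (false, none, _, _), _ => none
  | (false, some s, v, j), some a =>
    let r := queueAct M j (some a) v s
    some ((true, r.1, r.2.1, j), r.2.2)
  | (false, some s, v, j), none =>
    let r := queueAct M j none v s
    some ((false, r.1, r.2.1, nextStack j), r.2.2)

/-- The content of a stack followed by a separator. -/
def segment : List Γ → List (Option Γ)
  | [] => [none]
  | a :: l => some a :: segment l

/-- The queue storing the given stacks, starting with the stack `j`. -/
def stackQueue (j : K') (S : K' → List Γ) : List (Option Γ) :=
  segment (S j) ++ (segment (S (nextStack j)) ++ (segment (S (nextStack (nextStack j))) ++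
    segment (S (nextStack (nextStack (nextStack j))))))

variable {M : Λ → Turing.TM2.Stmt (fun _ : K' => Γ) Λ σ}

theorem reaches_copy (s : Option (Turing.TM2.Stmt (fun _ : K' => Γ) Λ σ)) (v : σ) (j : K')
    (l : List Γ) (r : List (Option Γ)) :
    Reaches (queueStep (queueDelta M)) ((true, s, v, j), segment l ++ r)
      ((false, s, v, nextStack j), r ++ segment l) := by
  induction l generalizing r with
  | nil => exact .single rfl
  | cons a l ih =>
    refine .head (b := ((true, s, v, j), segment l ++ (r ++ [some a]))) ?_ ?_
    · simp [queueStep, segment, queueDelta]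
    · simpa [segment, Reaches] using ih (r ++ [some a])

theorem reaches_pass {s : Turing.TM2.Stmt (fun _ : K' => Γ) Λ σ} {v v' : σ} {j : K'}
    {S : K' → List Γ} {s' : Option (Turing.TM2.Stmt (fun _ : K' => Γ) Λ σ)}
    {o : List (Option Γ)} {L : List Γ} (hact : queueAct M j (S j).head? v s = (s', v', o))
    (hL : o ++ (segment (S j)).tail = segment L) :
    Reaches₁ (queueStep (queueDelta M)) ((false, some s, v, j), stackQueue j S)
      ((false, s', v', nextStack j), stackQueue (nextStack j) (Function.update S j L)) := by
  set R := segment (S (nextStack j)) ++ (segment (S (nextStack (nextStack j))) ++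
    segment (S (nextStack (nextStack (nextStack j))))) with hR
  have h₁ : stackQueue (nextStack j) (Function.update S j L) = R ++ segment L := by
    cases j <;> simp [stackQueue, nextStack, R]
  have h₂ : stackQueue j S = segment (S j) ++ R := rfl
  rw [h₁, h₂, ← hL]
  cases hS : S j with
  | nil =>
    rw [hS] at hact
    refine .single ?_
    simp [queueStep, segment, queueDelta, show queueAct M j none v s = _ from hact]
  | cons a l =>
    rw [hS] at hact
    refine Relation.TransGen.head' (b := ((true, s', v', j), segment l ++ (R ++ o))) ?_ ?_
    · simp [queueStep, segment, queueDelta, show queueAct M j (some a) v s = _ from hact]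
    · simpa [segment, Reaches] using reaches_copy s' v' j l (R ++ o)

theorem reaches_skip {s : Turing.TM2.Stmt (fun _ : K' => Γ) Λ σ} {v : σ} {k : K'}
    (h : ∀ j ≠ k, ∀ c, queueAct M j c v s = (some s, v, [c])) (S : K' → List Γ) (j : K') :
    Reaches (queueStep (queueDelta M)) ((false, some s, v, j), stackQueue j S)
      ((false, some s, v, k), stackQueue k S) := by
  have H : ∀ j ≠ k, Reaches (queueStep (queueDelta M)) ((false, some s, v, j), stackQueue j S)
      ((false, some s, v, nextStack j), stackQueue (nextStack j) S) := by
    intro j hj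
    have := reaches_pass (L := S j) (h j hj (S j).head?) (by cases S j <;> rfl)
    rw [Function.update_eq_self] at this
    exact this.to_reflTransGen
  by_cases h₁ : j = k
  · subst h₁; exact .refl
  refine (H j h₁).trans ?_
  by_cases h₂ : nextStack j = k
  · subst h₂; exact .refl
  refine (H _ h₂).trans ?_
  by_cases h₃ : nextStack (nextStack j) = k
  · subst h₃; exact .refl
  refine (H _ h₃).trans ?_
  have h₄ : nextStack (nextStack (nextStack j)) = k := by
    cases j <;> cases k <;> simp_all [nextStack]
  subst h₄; exact .refl

/-- The configuration of the queue automaton, positioned at the stack `j`, that represents a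
configuration of a stack machine. -/
def queueCfg (M : Λ → Turing.TM2.Stmt (fun _ : K' => Γ) Λ σ)
    (c : Turing.TM2.Cfg (fun _ : K' => Γ) Λ σ) (j : K') : QueueState Γ Λ σ × List (Option Γ) :=
  ((false, c.l.map M, c.var, j), stackQueue j c.stk)

theorem exists_reaches_stepAux (s : Turing.TM2.Stmt (fun _ : K' => Γ) Λ σ) (v : σ)
    (S : K' → List Γ) (j : K') :
    ∃ j', Reaches₁ (queueStep (queueDelta M)) ((false, some s, v, j), stackQueue j S)
      (queueCfg M (Turing.TM2.stepAux s v S) j') := by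
  have upd : ∀ (S : K' → List Γ) (j : K'), Function.update S j (S j) = S :=
    fun S j => Function.update_eq_self j S
  have hseg : ∀ l : List Γ, [l.head?] ++ (segment l).tail = segment l := by
    intro l; cases l <;> rfl
  induction s generalizing v S j with
  | push k f q ih =>
    obtain ⟨j', hj'⟩ := ih v (Function.update S k (f v :: S k)) (nextStack k)
    refine ⟨j', (Relation.TransGen.trans_right (reaches_skip ?_ S j)
      (reaches_pass (L := f v :: S k) (by simp [queueAct]; rfl) ?_)).trans hj'⟩
    · intro j hj c; simp [queueAct, hj]
    · cases S k <;> rfl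
  | peek k f q ih =>
    obtain ⟨j', hj'⟩ := ih (f v (S k).head?) S (nextStack k)
    refine ⟨j', (Relation.TransGen.trans_right (reaches_skip ?_ S j)
      (upd S k ▸ reaches_pass (L := S k) (by simp [queueAct]; rfl) ?_)).trans hj'⟩
    · intro j hj c; simp [queueAct, hj]
    · exact hseg _
  | pop k f q ih =>
    obtain ⟨j', hj'⟩ := ih (f v (S k).head?) (Function.update S k (S k).tail) (nextStack k)
    refine ⟨j', (Relation.TransGen.trans_right (reaches_skip ?_ S j)
      (reaches_pass (L := (S k).tail) (by simp [queueAct]; rfl) ?_)).trans hj'⟩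
    · intro j hj c; simp [queueAct, hj]
    · cases S k <;> rfl
  | load a q ih =>
    obtain ⟨j', hj'⟩ := ih (a v) S (nextStack j)
    have := reaches_pass (M := M) (s := .load a q) (v := v) (L := S j) rfl (hseg _)
    rw [upd] at this
    exact ⟨j', this.trans hj'⟩
  | branch p q₁ q₂ ih₁ ih₂ =>
    have H : Reaches₁ (queueStep (queueDelta M))
      ((false, some (.branch p q₁ q₂), v, j), stackQueue j S)
      ((false, some (cond (p v) q₁ q₂), v, nextStack j), stackQueue (nextStack j) S) := by
      have := reaches_pass (M := M) (s := .branch p q₁ q₂) (v := v) (L := S j) rfl (hseg _)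
      rwa [upd] at this
    rw [Turing.TM2.stepAux]
    cases hp : p v with
    | true =>
      obtain ⟨j', hj'⟩ := ih₁ v S (nextStack j)
      exact ⟨j', (hp ▸ H).trans hj'⟩
    | false =>
      obtain ⟨j', hj'⟩ := ih₂ v S (nextStack j)
      exact ⟨j', (hp ▸ H).trans hj'⟩
  | goto l =>
    refine ⟨nextStack j, ?_⟩
    have := reaches_pass (M := M) (s := .goto l) (v := v) (L := S j) rfl (hseg _)
    rwa [upd] at this
  | halt =>
    refine ⟨nextStack j, ?_⟩
    have := reaches_pass (M := M) (s := .halt) (v := v) (L := S j) rfl (hseg _)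
    rwa [upd] at this

theorem respects_queueCfg : Respects (Turing.TM2.step M) (queueStep (queueDelta M))
    fun c d => ∃ j, d = queueCfg M c j := by
  rintro ⟨_ | l, v, S⟩ _ ⟨j, rfl⟩
  · simp only [Turing.TM2.step]
    unfold queueCfg stackQueue
    cases h : S j <;> simp [h, segment, queueStep, queueDelta]
  · obtain ⟨j', hj'⟩ := exists_reaches_stepAux (M := M) (M l) v S j
    exact ⟨_, ⟨j', rfl⟩, hj'⟩

theorem stackQueue_ne_nil (j : K') (S : K' → List Γ) : stackQueue j S ≠ [] := by
  unfold stackQueue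
  cases S j <;> simp [segment]

theorem queueDelta_eq_none {q : QueueState Γ Λ σ} {a b : Option Γ} (h : queueDelta M q a = none) :
    queueDelta M q b = none := by
  obtain ⟨_ | _, _ | s, v, j⟩ := q <;> cases a <;> cases b <;> simp_all [queueDelta]

open Turing.TM2 in
theorem queueDelta_mem_stmts [Inhabited Λ] {S : Finset Λ} (hM : Turing.TM2.Supports M S)
    {q q' : QueueState Γ Λ σ} {a : Option Γ} {u : List (Option Γ)}
    (hq : q.2.1 ∈ Turing.TM2.stmts M S) (h : queueDelta M q a = some (q', u)) :
    q'.2.1 ∈ Turing.TM2.stmts M S := by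
  have H : ∀ s j c v, some s ∈ stmts M S → (queueAct M j c v s).1 ∈ stmts M S := by
    intro s j c v hs
    have hsup := stmts_supportsStmt hM hs
    cases s with
    | halt => simp [queueAct, stmts]
    | goto l =>
      simp only [queueAct, stmts, Finset.mem_insertNone, Finset.mem_biUnion, Option.mem_def,
        Option.some.injEq, forall_eq']
      exact ⟨l v, hsup v, stmts₁_self⟩
    | branch p q₁ q₂ =>
      refine stmts_trans ?_ hs
      cases p v <;> simp [stmts₁, stmts₁_self]
    | load a q => exact stmts_trans (by simp [stmts₁, stmts₁_self]) hs
    | _ =>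
      simp only [queueAct]
      split
      · exact stmts_trans (by simp [stmts₁, stmts₁_self]) hs
      · exact hs
  obtain ⟨_ | _, _ | s, v, j⟩ := q <;> cases a <;> simp [queueDelta] at h <;>
    obtain ⟨rfl, -⟩ := h <;> first | exact hq | exact H _ _ _ _ hq

end StackMachine

section BinaryAlphabet

open StateTransition

variable {Q A : Type}

/-- The code of a letter over the binary alphabet. -/
def bitCode (e : A → ℕ) (a : A) : List Bool :=
  List.replicate (e a) false ++ [true]

open scoped Classical in
/-- The transition function of a queue automaton over the binary alphabet simulating a queue
automaton over the alphabet `A`, the letters of which have the unary codes `e a < N`. -/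
noncomputable def bitDelta (δ : Q → A → Option (Q × List A)) (e : A → ℕ) (N : ℕ) :
    Q × ℕ → Bool → Option ((Q × ℕ) × List Bool) := fun q b =>
  if ∀ a, δ q.1 a = none then none
  else cond b
    ((Function.partialInv e q.2).bind fun a =>
      (δ q.1 a).map fun x => ((x.1, 0), x.2.flatMap (bitCode e)))
    (if q.2 + 1 < N then some ((q.1, q.2 + 1), []) else none)

variable {δ : Q → A → Option (Q × List A)} {e : A → ℕ} {N : ℕ}

theorem reaches_replicate_false {q : Q} (hq : ¬ ∀ a, δ q a = none) (n i : ℕ) (r : List Bool)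
    (h : i + n < N) : Reaches (queueStep (bitDelta δ e N))
      ((q, i), List.replicate n false ++ r) ((q, i + n), r) := by
  induction n generalizing i with
  | zero => exact .refl
  | succ n ih =>
    refine .head (b := ((q, i + 1), List.replicate n false ++ r)) ?_ ?_
    · simp [queueStep, List.replicate_succ, bitDelta, hq, show i + 1 < N by omega]
    · have := ih (i + 1) (by omega)
      rwa [show i + 1 + n = i + (n + 1) by omega] at this

theorem respects_bitDelta (he : Function.Injective e) (hN : ∀ a, e a < N)
    (hδ : ∀ q a b, δ q a = none → δ q b = none) :
    Respects (queueStep δ) (queueStep (bitDelta δ e N))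
      fun c d => d = ((c.1, 0), c.2.flatMap (bitCode e)) := by
  rintro ⟨q, _ | ⟨a, l⟩⟩ _ rfl
  · rfl
  rcases h : δ q a with _ | ⟨q', u⟩
  · have hq : ∀ b, δ q b = none := fun b => hδ q a b h
    simp only [queueStep, h, Option.map_none]
    rcases List.flatMap (bitCode e) (a :: l) with _ | ⟨b, l⟩
    · rfl
    · simp [bitDelta, hq]
  · have hq : ¬ ∀ b, δ q b = none := fun hq => by simp [hq] at h
    simp only [queueStep, h, Option.map_some]
    refine ⟨_, rfl, ?_⟩
    have := reaches_replicate_false (δ := δ) (e := e) (N := N) hq (e a) 0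
      (true :: l.flatMap (bitCode e)) (by simpa using hN a)
    refine Relation.TransGen.tail' (b := ((q, 0 + e a), true :: l.flatMap (bitCode e))) ?_ ?_
    · simpa [bitCode, Reaches] using this
    · simp [queueStep, bitDelta, hq, Function.partialInv_left he, h]

end BinaryAlphabet

section Reduction

open Turing.PartrecToTM2 (K' Γ' Λ' trNormal tr codeSupp trList trNat)

theorem primrec_deviations : Primrec deviations := by
  have : deviations = fun l => l.foldr (fun b s => [!b] :: s.map (b :: ·)) [] := by
    funext l
    induction l with
    | nil => rfl
    | cons b l ih => simp [deviations, ih]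
  rw [this]
  refine Primrec.list_foldr (h := fun _ p => [!p.1] :: p.2.map (p.1 :: ·)) Primrec.id (.const []) ?_
  have hb : Primrec fun p : List Bool × Bool × List (List Bool) => [!p.2.1] :=
    Primrec.list_cons.comp (Primrec.not.comp (Primrec.fst.comp Primrec.snd))
      (Primrec.const ([] : List Bool))
  refine Primrec.list_cons.comp hb (Primrec.list_map (Primrec.snd.comp Primrec.snd) ?_)
  exact Primrec.list_cons.comp (Primrec.fst.comp (Primrec.snd.comp Primrec.fst)) Primrec.snd

theorem primrec_startRules (i : ℕ) : Primrec (startRules i) := by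
  unfold startRules
  refine Primrec.list_cons.comp (Primrec.pair (.const 0) (Primrec.pair Primrec.id (.const _)))
    (Primrec.list_map primrec_deviations ?_)
  exact Primrec.pair (.const 0) (Primrec.pair Primrec.snd (.const _))

/-- There is a program that halts on `2 ^ n` if and only if the `n`-th partial recursive
function is defined at `0`. -/
theorem exists_universal_code : ∃ c : Turing.ToPartrec.Code, ∀ x : Nat.Partrec.Code,
    (c.eval [2 ^ Encodable.encode x]).Dom ↔ (x.eval 0).Dom := by
  let f : ℕ →. ℕ := fun m => (Nat.rfind fun n => Part.some (decide (m ≤ 2 ^ n))).bind fun n =>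
    Nat.Partrec.Code.eval (Denumerable.ofNat Nat.Partrec.Code n) 0
  have hpow : Primrec₂ fun m n : ℕ => m ^ n := Primrec₂.unpaired'.1 Nat.Primrec.pow
  have hf : Partrec f := by
    refine Partrec.bind (Partrec.rfind (Computable.partrec (Primrec.to_comp ?_)))
      (Nat.Partrec.Code.eval_part.comp ((Computable.ofNat _).comp Computable.snd)
        (Computable.const 0))
    exact Primrec.nat_le.decide.comp Primrec.fst (hpow.comp (.const 2) Primrec.snd)
  obtain ⟨c, hc⟩ := Turing.ToPartrec.Code.exists_code (Nat.Partrec'.part_iff₁.2 hf)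
  refine ⟨c, fun x => ?_⟩
  have h := hc ⟨[2 ^ Encodable.encode x], rfl⟩
  have hfind : (Nat.rfind fun n => Part.some (decide (2 ^ Encodable.encode x ≤ 2 ^ n))) =
      Part.some (Encodable.encode x) := by
    refine Part.eq_some_iff.2 (Nat.mem_rfind.2 ⟨by simp, fun {m} hm => ?_⟩)
    simpa using Nat.pow_lt_pow_right one_lt_two hm
  have hfx : f (2 ^ Encodable.encode x) = x.eval 0 := by
    simp only [f, hfind, Part.bind_some, Denumerable.ofNat_encode]
  rw [h]
  change (f (2 ^ Encodable.encode x)).Dom ↔ _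
  rw [hfx]

theorem trNat_two_pow (n : ℕ) : trNat (2 ^ n) = List.replicate n Γ'.bit0 ++ [Γ'.bit1] := by
  have h : ∀ n : ℕ, ∃ p : PosNum, ((2 ^ n : ℕ) : Num) = .pos p ∧
      Turing.PartrecToTM2.trPosNum p = List.replicate n Γ'.bit0 ++ [Γ'.bit1] := by
    intro n
    induction n with
    | zero => exact ⟨.one, rfl, rfl⟩
    | succ n ih =>
      obtain ⟨p, hp, hp'⟩ := ih
      refine ⟨.bit0 p, ?_, by simp [Turing.PartrecToTM2.trPosNum, hp', List.replicate_succ]⟩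
      rw [pow_succ, mul_two, Nat.cast_add, hp]
      exact congrArg Num.pos (PosNum.bit0_of_bit0 p)
  obtain ⟨p, hp, hp'⟩ := h n
  rw [trNat, hp]
  exact hp'

theorem segment_replicate_append {Γ : Type} (n : ℕ) (a : Γ) (l : List Γ) :
    segment (List.replicate n a ++ l) = List.replicate n (some a) ++ segment l := by
  induction n with
  | zero => rfl
  | succ n ih => simp [List.replicate_succ, segment, ih]

theorem primrec_flatMap_replicate_append {A : Type} (f : A → List Bool) (a : A) (r : List A) :
    Primrec fun n => (List.replicate n a ++ r).flatMap f := by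
  refine (Primrec.nat_rec₁ (r.flatMap f) (f := fun _ s => f a ++ s) ?_).of_eq fun n => ?_
  · exact Primrec.list_append.comp (.const _) Primrec.snd
  · induction n with
    | zero => rfl
    | succ n ih => simp [List.replicate_succ, ih]

/-- There is a computable map from programs to lists of rules such that the degree of
non-regularity is bounded if and only if the program halts. -/
theorem exists_reduction : ∃ f : Nat.Partrec.Code → List LinRule, Computable f ∧
    ∀ x, (∃ c, ∀ w k, Gen (f x) 0 w k → ∃ k' ≤ c, Gen (f x) 0 w k') ↔ (x.eval 0).Dom := by
  classical
  obtain ⟨c, hc⟩ := exists_universal_code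
  let M : Λ' → Turing.TM2.Stmt (fun _ : K' => Γ') Λ' (Option Γ') := tr
  let S := codeSupp c .halt
  let l₀ := trNormal c .halt
  have hM : @Turing.TM2.Supports _ _ _ _ ⟨l₀⟩ M S := Turing.PartrecToTM2.tr_supports c .halt
  let e : Option Γ' → ℕ := fun a => Fintype.equivFin (Option Γ') a
  have he : Function.Injective e := Fin.val_injective.comp (Fintype.equivFin _).injective
  let N := Fintype.card (Option Γ')
  have hN : ∀ a, e a < N := fun a => (Fintype.equivFin (Option Γ') a).2
  let δ := bitDelta (queueDelta M) e N
  let names : Finset K' := {.main, .rev, .aux, .stack}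
  have hnames : ∀ j, j ∈ names := by intro j; cases j <;> simp [names]
  let F : Finset (QueueState Γ' Λ' (Option Γ') × ℕ) :=
    (Finset.univ ×ˢ Turing.TM2.stmts M S ×ˢ Finset.univ ×ˢ names) ×ˢ Finset.range N
  have hmemF : ∀ q : QueueState Γ' Λ' (Option Γ') × ℕ,
      q ∈ F ↔ q.1.2.1 ∈ Turing.TM2.stmts M S ∧ q.2 < N := by
    intro q; simp [F, hnames]
  have hN₀ : 0 < N := Fintype.card_pos
  let ι : QueueState Γ' Λ' (Option Γ') × ℕ → ℕ := fun q =>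
    if h : q ∈ F then F.equivFin ⟨q, h⟩ else 0
  have hι : Set.InjOn ι F := by
    intro q hq q' hq' h
    rw [Finset.mem_coe] at hq hq'
    simpa [ι, hq, hq', Fin.val_inj] using h
  have hF : ∀ q ∈ F, ∀ b q' u, δ q b = some (q', u) → q' ∈ F := by
    intro q hq b q' u h
    rw [hmemF] at hq ⊢
    by_cases hall : ∀ a, queueDelta M q.1 a = none
    · simp [δ, bitDelta, hall] at h
    · cases b with
      | false =>
        simp only [δ, bitDelta, hall, if_false, cond_false] at h
        split at h
        · cases h; exact ⟨hq.1, by assumption⟩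
        · cases h
      | true =>
        simp only [δ, bitDelta, hall, if_false, cond_true] at h
        obtain ⟨a, -, h⟩ := Option.bind_eq_some_iff.1 h
        obtain ⟨x, hx, h⟩ := Option.map_eq_some_iff.1 h
        cases h
        exact ⟨@queueDelta_mem_stmts _ _ _ _ ⟨l₀⟩ _ hM _ _ _ _ hq.1 hx, hN₀⟩
  let q₀ : QueueState Γ' Λ' (Option Γ') × ℕ := ((false, some (M l₀), none, .main), 0)
  have hq₀ : q₀ ∈ F := by
    rw [hmemF]
    refine ⟨?_, hN₀⟩
    simp only [q₀, Turing.TM2.stmts, Finset.mem_insertNone, Finset.mem_biUnion, Option.mem_def,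
      Option.some.injEq, forall_eq']
    exact ⟨l₀, hM.1, Turing.TM2.stmts₁_self⟩
  let word : ℕ → List Bool := fun n =>
    (stackQueue .main (K'.elim (trList [2 ^ n]) [] [] [])).flatMap (bitCode e)
  have hword : Primrec word := by
    refine (primrec_flatMap_replicate_append (bitCode e) (some Γ'.bit0)
      [some Γ'.bit1, some Γ'.cons, none, none, none, none]).of_eq fun n => ?_
    have : trList [2 ^ n] = List.replicate n Γ'.bit0 ++ [Γ'.bit1, Γ'.cons] := by
      simp [trList, trNat_two_pow]
    simp only [word, stackQueue, nextStack, K'.elim, this, segment_replicate_append, segment]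
    simp
  have hδ := respects_bitDelta he hN
    fun q a b => queueDelta_eq_none (M := M) (q := q) (a := a) (b := b)
  refine ⟨fun x => machineRules δ ι F ++ startRules (ι q₀) (word (Encodable.encode x)), ?_,
    fun x => ?_⟩
  · exact Computable.list_append.comp (Computable.const _)
      (((primrec_startRules _).comp (hword.comp Primrec.encode)).to_comp)
  · let c₀ := Turing.PartrecToTM2.init c [2 ^ Encodable.encode x]
    have h₁ := StateTransition.tr_eval_dom (respects_queueCfg (M := M)) (a₁ := c₀) ⟨.main, rfl⟩
    have h₂ := StateTransition.tr_eval_dom hδ (a₁ := queueCfg M c₀ .main) rfl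
    rw [← hc x]
    refine (bounded_iff_halts hι hF hq₀ _ ?_).trans (h₂.trans (h₁.trans ?_))
    · intro d hd
      obtain ⟨d₁, rfl, hd₁⟩ :=
        StateTransition.tr_eval_rev hδ (a₁ := queueCfg M c₀ .main) rfl hd
      obtain ⟨d₂, ⟨j, rfl⟩, -⟩ :=
        StateTransition.tr_eval_rev (respects_queueCfg (M := M)) (a₁ := c₀) ⟨.main, rfl⟩ hd₁
      obtain ⟨a, l, hl⟩ := List.exists_cons_of_ne_nil (stackQueue_ne_nil j d₂.stk)
      simp [queueCfg, hl, bitCode]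
    · have := Turing.PartrecToTM2.tr_eval c [2 ^ Encodable.encode x]
      change (StateTransition.eval (Turing.TM2.step tr) c₀).Dom ↔ _
      rw [this]
      rfl

end Reduction

end LinGrammar

/-- Given a linear context-free grammar, it is undecidable whether its degree of
non-regularity is bounded by a constant, i.e., in `O(1)`. -/
theorem undecidable_dnreg_bounded_linear :
    ¬ ComputablePred (fun rs : List LinRule => ∃ c : ℕ, ∀ n : ℕ, dnregFun (linCFG rs) n ≤ c) := by
  intro h
  obtain ⟨f, hf, hfx⟩ := LinGrammar.exists_reduction
  refine ComputablePred.halting_problem 0 (ComputablePred.computable_of_manyOneReducible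
    ⟨f, hf, fun x => ?_⟩ h)
  rw [LinGrammar.dnregFun_bounded_iff, hfx]
end

section
/- Let L be a deterministic context-free language that is not regular. If L ∈ DNREG(f(n)) for some function f, then f(n) ∈ Ω(n). -/
/-- A deterministic pushdown automaton with input alphabet `T`. -/
structure DPDA (T : Type) where
  /-- States. -/
  Q : Type
  /-- Stack alphabet. -/
  Γ : Type
  [fQ : Fintype Q]
  [fΓ : Fintype Γ]
  /-- (Partial, deterministic) transition function. -/
  δ : Q → Option T → Γ → Option (Q × List Γ)
  /-- Determinism: if an ε-move is available then no letter-reading move is. -/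
  det : ∀ q Z, (δ q none Z).isSome → ∀ a : T, δ q (some a) Z = none
  /-- Initial state. -/
  q₀ : Q
  /-- Initial stack symbol. -/
  Z₀ : Γ
  /-- Final states. -/
  F : Set Q

/-- Reachability between configurations of a DPDA. -/
inductive DPDA.Steps (P : DPDA T) :
    P.Q × List T × List P.Γ → P.Q × List T × List P.Γ → Prop
  | refl (c : P.Q × List T × List P.Γ) : Steps P c c
  | step {p : P.Q} {w : List T} {γ α : List P.Γ} {c : P.Q × List T × List P.Γ} {Z : P.Γ}
      {q : P.Q} {a : Option T} (h : P.δ q a Z = some (p, α))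
      (ih : Steps P (p, w, α ++ γ) c) : Steps P (q, a.toList ++ w, Z :: γ) c

/-- The language accepted (by final state) by a DPDA. -/
def DPDA.language (P : DPDA T) : Language T :=
  {w | ∃ q ∈ P.F, ∃ γ : List P.Γ, P.Steps (P.q₀, w, [P.Z₀]) (q, [], γ)}

/-- The `n`-th power of a word. -/
def List.pow {α : Type} (v : List α) (n : ℕ) : List α := (List.replicate n v).flatten

@[simp] lemma List.pow_zero' {α : Type} (v : List α) : v.pow 0 = [] := rfl

lemma List.pow_succ' {α : Type} (v : List α) (n : ℕ) : v.pow (n + 1) = v ++ v.pow n := rfl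

lemma List.pow_add' {α : Type} (v : List α) (n m : ℕ) :
    v.pow (n + m) = v.pow n ++ v.pow m := by
  rw [List.pow, List.replicate_add, List.flatten_append]
  rfl

@[simp] lemma List.length_pow' {α : Type} (v : List α) (n : ℕ) :
    (v.pow n).length = n * v.length := by
  simp [List.pow]

lemma List.append_pow_eq_pow_append {α : Type} {a u x : List α} (h : u ++ a = a ++ x) (n : ℕ) :
    u.pow n ++ a = a ++ x.pow n := by
  induction n with
  | zero => simp
  | succ n ih =>
    rw [List.pow_succ', List.pow_succ', List.append_assoc, ih, ← List.append_assoc, h,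
      List.append_assoc]

lemma List.pow_mul' {α : Type} (v : List α) (c n : ℕ) : (v.pow c).pow n = v.pow (n * c) := by
  induction n with
  | zero => simp
  | succ n ih => rw [List.pow_succ', ih, Nat.succ_mul, Nat.add_comm, List.pow_add']

/-- Pumping a factor of a power whose length is a multiple of the period. -/
lemma List.pow_eq_of_factor {α : Type} {v a x b : List α} {m c : ℕ}
    (h : v.pow m = a ++ x ++ b) (hx : x.length = c * v.length) (n : ℕ) :
    a ++ x.pow (n + 1) ++ b = v.pow (m + n * c) := by
  have h1 : (v.pow c ++ a) ++ (x ++ b) = (a ++ x) ++ (b ++ v.pow c) := by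
    have e1 : (v.pow c ++ a) ++ (x ++ b) = v.pow (c + m) := by
      rw [List.pow_add', h]
      simp
    have e2 : (a ++ x) ++ (b ++ v.pow c) = v.pow (m + c) := by
      rw [List.pow_add', h]
      simp
    rw [e1, e2, add_comm]
  have h2 : v.pow c ++ a = a ++ x :=
    (List.append_inj h1 (by simp only [List.length_append, List.length_pow']; omega)).1
  have h3 := List.append_pow_eq_pow_append h2 n
  rw [List.pow_mul'] at h3
  rw [List.pow_add' x n 1, ← List.append_assoc, ← h3, add_comm m, List.pow_add', h]
  simp [List.pow_succ']

/-- A predicate on natural numbers is eventually constant. -/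
def EventuallyConst (φ : ℕ → Prop) : Prop := ∃ d₀, ∀ d ≥ d₀, (φ d ↔ φ d₀)

lemma EventuallyConst.of_imp_succ {φ : ℕ → Prop} (h : ∀ d, φ d → φ (d + 1)) :
    EventuallyConst φ := by
  by_cases hφ : ∃ d, φ d
  · obtain ⟨d₀, h₀⟩ := hφ
    exact ⟨d₀, fun d hd => iff_of_true (Nat.le_induction h₀ (fun n _ => h n) d hd) h₀⟩
  · push Not at hφ
    exact ⟨0, fun d _ => iff_of_false (hφ d) (hφ 0)⟩

lemma EventuallyConst.of_succ {φ : ℕ → Prop} (h : EventuallyConst fun d => φ (d + 1)) :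
    EventuallyConst φ := by
  obtain ⟨d₀, h₀⟩ := h
  refine ⟨d₀ + 1, fun d hd => ?_⟩
  obtain ⟨e, rfl⟩ := Nat.exists_eq_add_of_le' (show 1 ≤ d by omega)
  exact h₀ e (by omega)

/-- The pumping property for powers: a power `v ^ m` that makes up a linear portion of a long word
of `L` can be pumped by multiples of a constant depending only on `v`. -/
def Language.PumpsPowers {T : Type} (L : Language T) : Prop :=
  ∀ v : List T, v ≠ [] → ∃ D > 0, ∀ e, ∃ n₀, ∀ a b m, n₀ ≤ (a ++ v.pow m ++ b).length →
    (a ++ v.pow m ++ b).length ≤ e * m → a ++ v.pow m ++ b ∈ L →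
      ∀ j, a ++ v.pow (m + j * D) ++ b ∈ L

lemma Language.PumpsPowers.two {L : Language T} (hL : L.PumpsPowers) {v x : List T}
    (hv : v ≠ []) (hx : x ≠ []) : ∃ D > 0, ∀ a b c d, ∃ m,
      a ++ v.pow (m + d) ++ b ++ x.pow m ++ c ∈ L → ∀ j,
        a ++ v.pow (m + d + j * D) ++ b ++ x.pow m ++ c ∈ L ∧
        a ++ v.pow (m + d) ++ b ++ x.pow (m + j * D) ++ c ∈ L := by
  obtain ⟨D₁, hD₁, h₁⟩ := hL v hv
  obtain ⟨D₂, hD₂, h₂⟩ := hL x hx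
  refine ⟨D₁ * D₂, by positivity, fun a b c d => ?_⟩
  obtain ⟨n₁, h₁⟩ := h₁ (1 + v.length + x.length)
  obtain ⟨n₂, h₂⟩ := h₂ (1 + v.length + x.length)
  have hv' := List.length_pos_of_ne_nil hv
  have hx' := List.length_pos_of_ne_nil hx
  set N := a.length + b.length + c.length + d * v.length + n₁ + n₂ with hN
  refine ⟨N, fun hmem j => ⟨?_, ?_⟩⟩
  · have := h₁ a (b ++ x.pow N ++ c) (N + d) ?_ ?_ (by simpa using hmem) (j * D₂)
    · rw [mul_assoc, mul_comm D₂ D₁] at this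
      simpa using this
    · simp only [List.length_append, List.length_pow']
      nlinarith
    · simp only [List.length_append, List.length_pow']
      nlinarith
  · have := h₂ (a ++ v.pow (N + d) ++ b) c N ?_ ?_ (by simpa using hmem) (j * D₁)
    · rw [mul_assoc] at this
      simpa using this
    · simp only [List.length_append, List.length_pow']
      nlinarith
    · simp only [List.length_append, List.length_pow']
      nlinarith

/-- Ramsey's theorem for monochromatic triangles on ordered vertices. -/
lemma exists_monochromatic_triangle {K : Type} (n : ℕ) :
    ∃ N : ℕ, ∀ (f : ℕ → ℕ → K) (C : Finset K), C.card ≤ n → ∀ S : Finset ℕ, N ≤ S.card →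
      (∀ i ∈ S, ∀ j ∈ S, i < j → f i j ∈ C) →
        ∃ i ∈ S, ∃ j ∈ S, ∃ k ∈ S, i < j ∧ j < k ∧ f i j = f j k ∧ f i k = f j k := by
  classical
  induction n with
  | zero =>
    refine ⟨2, fun f C hC S hS h => ?_⟩
    obtain ⟨a, ha, b, hb, hab⟩ := Finset.one_lt_card.1 hS
    have hC' : C = ∅ := by simpa using hC
    subst hC'
    rcases lt_or_gt_of_ne hab with hlt | hlt
    · exact absurd (h a ha b hb hlt) (by simp)
    · exact absurd (h b hb a ha hlt) (by simp)
  | succ n ih =>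
    obtain ⟨N, hN⟩ := ih
    refine ⟨(n + 1) * N + 2, fun f C hC S hS h => ?_⟩
    have hne : S.Nonempty := Finset.card_pos.1 (by omega)
    set i := S.min' hne with hi
    have hiS : i ∈ S := S.min'_mem hne
    have hlt : ∀ j ∈ S.erase i, i < j := fun j hj =>
      lt_of_le_of_ne (S.min'_le j (Finset.mem_of_mem_erase hj)) (Finset.ne_of_mem_erase hj).symm
    have hcard : C.card * N < (S.erase i).card := by
      rw [Finset.card_erase_of_mem hiS]
      have := Nat.mul_le_mul_right N hC
      omega
    obtain ⟨c, hc, hcN⟩ := Finset.exists_lt_card_fiber_of_mul_lt_card_of_maps_to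
      (f := fun j => f i j) (fun j hj => h i hiS j (Finset.mem_of_mem_erase hj) (hlt j hj)) hcard
    set S' := (S.erase i).filter (fun j => f i j = c) with hS'
    have hmem : ∀ j ∈ S', j ∈ S ∧ i < j ∧ f i j = c := fun j hj => by
      rw [hS', Finset.mem_filter] at hj
      exact ⟨Finset.mem_of_mem_erase hj.1, hlt j hj.1, hj.2⟩
    by_cases hex : ∃ j ∈ S', ∃ k ∈ S', j < k ∧ f j k = c
    · obtain ⟨j, hj, k, hk, hjk, hf⟩ := hex
      obtain ⟨h1, h2, h3⟩ := hmem j hj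
      obtain ⟨h4, h5, h6⟩ := hmem k hk
      exact ⟨i, hiS, j, h1, k, h4, h2, hjk, h3.trans hf.symm, h6.trans hf.symm⟩
    · push Not at hex
      obtain ⟨i', hi', j, hj, k, hk, hh⟩ := hN f (C.erase c)
        (by rw [Finset.card_erase_of_mem hc]; omega) S' hcN.le (fun a ha b hb hab =>
          Finset.mem_erase.2 ⟨hex a ha b hb hab, h a (hmem a ha).1 b (hmem b hb).1 hab⟩)
      exact ⟨i', (hmem _ hi').1, j, (hmem _ hj).1, k, (hmem _ hk).1, hh⟩

/-- A transitive dense relation on a finite type has a reflexive point between any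
two related elements. -/
lemma exists_refl_between {α : Type} [Finite α] {E : α → α → Prop}
    (htrans : ∀ x y z, E x y → E y z → E x z) (hdense : ∀ x y, E x y → ∃ s, E x s ∧ E s y)
    {x y : α} (hxy : E x y) : ∃ r, E x r ∧ E r r ∧ E r y := by
  by_contra! hcon
  let S := {r // E x r ∧ E r y}
  let R : S → S → Prop := fun a b => E a.1 b.1
  have : IsTrans S R := ⟨fun a b c => htrans a.1 b.1 c.1⟩
  have : Std.Irrefl R := ⟨fun a ha => hcon a.1 a.2.1 ha a.2.2⟩
  have hwf : WellFounded R := Finite.wellFounded_of_trans_of_irrefl R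
  obtain ⟨s, h1, h2⟩ := hdense x y hxy
  obtain ⟨m, -, hm⟩ := hwf.has_min Set.univ ⟨(⟨s, h1, h2⟩ : S), trivial⟩
  obtain ⟨t, h3, h4⟩ := hdense x m.1 m.2.1
  exact hm ⟨t, h3, htrans _ _ _ h4 m.2.2⟩ trivial h4

namespace DPDA

attribute [local instance] DPDA.fQ DPDA.fΓ

variable {T : Type} {P : DPDA T}

/-- `P.Run n q γ w p δ`: in exactly `n` moves, reading exactly the word `w`, the automaton goes
from state `q` with stack `γ` to state `p` with stack `δ`. -/
inductive Run (P : DPDA T) : ℕ → P.Q → List P.Γ → List T → P.Q → List P.Γ → Prop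
  | refl (q : P.Q) (γ : List P.Γ) : Run P 0 q γ [] q γ
  | step {n : ℕ} {q p r : P.Q} {a : Option T} {Z : P.Γ} {α γ δ : List P.Γ} {w : List T}
      (h : P.δ q a Z = some (p, α)) (ih : Run P n p (α ++ γ) w r δ) :
      Run P (n + 1) q (Z :: γ) (a.toList ++ w) r δ

/-- Acceptance of a word from a given state and stack. -/
def Acc (P : DPDA T) (q : P.Q) (γ : List P.Γ) (z : List T) : Prop :=
  ∃ n, ∃ f ∈ P.F, ∃ δ, P.Run n q γ z f δ

/-- `P.Pop q β r`: starting in state `q`, the stack word `β` can be popped, ending in `r`. -/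
def Pop (P : DPDA T) (q : P.Q) (β : List P.Γ) (r : P.Q) : Prop :=
  ∃ n w, P.Run n q β w r []

lemma Run.eq_of_zero {q p : P.Q} {γ δ : List P.Γ} {w : List T} (h : P.Run 0 q γ w p δ) :
    w = [] ∧ p = q ∧ δ = γ := by
  cases h; simp

lemma Run.exists_of_succ {n : ℕ} {q r : P.Q} {γ δ : List P.Γ} {w : List T}
    (h : P.Run (n + 1) q γ w r δ) :
    ∃ a Z γ' p α w', γ = Z :: γ' ∧ w = a.toList ++ w' ∧ P.δ q a Z = some (p, α) ∧
      P.Run n p (α ++ γ') w' r δ := by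
  cases h with
  | step h ih => exact ⟨_, _, _, _, _, _, rfl, rfl, h, ih⟩

lemma Run.eq_of_nil {n : ℕ} {q p : P.Q} {δ : List P.Γ} {w : List T}
    (h : P.Run n q [] w p δ) : n = 0 ∧ w = [] ∧ p = q ∧ δ = [] := by
  cases n with
  | zero => simpa using h.eq_of_zero
  | succ n =>
    obtain ⟨a, Z, γ', p, α, w', h1, -⟩ := h.exists_of_succ
    simp at h1

lemma Run.trans {n m : ℕ} {q p r : P.Q} {γ δ ε : List P.Γ} {w w' : List T}
    (h : P.Run n q γ w p δ) (h' : P.Run m p δ w' r ε) :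
    P.Run (n + m) q γ (w ++ w') r ε := by
  induction h with
  | refl => simpa using h'
  | step h _ ih =>
    rw [List.append_assoc, Nat.add_right_comm]
    exact Run.step h (ih h')

lemma Run.append {n : ℕ} {q p : P.Q} {γ δ : List P.Γ} {w : List T}
    (h : P.Run n q γ w p δ) (ρ : List P.Γ) : P.Run n q (γ ++ ρ) w p (δ ++ ρ) := by
  induction h with
  | refl => exact Run.refl _ _
  | step h _ ih =>
    rw [List.append_assoc] at ih
    exact Run.step h ih

lemma Run.split {n k : ℕ} {q p : P.Q} {γ δ : List P.Γ} {w : List T}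
    (h : P.Run (n + k) q γ w p δ) :
    ∃ r ε w₁ w₂, w = w₁ ++ w₂ ∧ P.Run n q γ w₁ r ε ∧ P.Run k r ε w₂ p δ := by
  induction n generalizing q γ w with
  | zero => exact ⟨q, γ, [], w, rfl, Run.refl _ _, by simpa using h⟩
  | succ n ih =>
    rw [Nat.add_right_comm] at h
    obtain ⟨a, Z, γ', p', α, w', rfl, rfl, hδ, h'⟩ := h.exists_of_succ
    obtain ⟨r, ε, w₁, w₂, rfl, h1, h2⟩ := ih h'
    exact ⟨r, ε, a.toList ++ w₁, w₂, by simp, Run.step hδ h1, h2⟩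

/-- A run from a stack `α ++ γ` either leaves `γ` intact or pops `α` completely. -/
lemma Run.split_stack {n : ℕ} {q p : P.Q} {α γ δ : List P.Γ} {w : List T}
    (h : P.Run n q (α ++ γ) w p δ) :
    (∃ δ', δ = δ' ++ γ ∧ P.Run n q α w p δ') ∨
      ∃ n₁ n₂ r w₁ w₂, n = n₁ + n₂ ∧ w = w₁ ++ w₂ ∧ P.Run n₁ q α w₁ r [] ∧
        P.Run n₂ r γ w₂ p δ := by
  induction n generalizing q α w with
  | zero =>
    obtain ⟨rfl, rfl, rfl⟩ := h.eq_of_zero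
    exact Or.inl ⟨α, rfl, Run.refl _ _⟩
  | succ n ih =>
    cases α with
    | nil => exact Or.inr ⟨0, n + 1, q, [], w, by simp, rfl, Run.refl _ _, h⟩
    | cons Z α =>
      obtain ⟨a, Z', γ', p', α', w', h1, rfl, hδ, h'⟩ := h.exists_of_succ
      simp only [List.cons_append, List.cons.injEq] at h1
      obtain ⟨rfl, rfl⟩ := h1
      rw [← List.append_assoc] at h'
      rcases ih h' with ⟨δ', rfl, h2⟩ | ⟨n₁, n₂, r, w₁, w₂, rfl, rfl, h2, h3⟩
      · exact Or.inl ⟨δ', rfl, Run.step hδ h2⟩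
      · exact Or.inr ⟨n₁ + 1, n₂, r, a.toList ++ w₁, w₂, by omega, by simp,
          Run.step hδ h2, h3⟩

/-- Determinism: two runs from the same configuration on a common input are comparable. -/
lemma Run.det {n k : ℕ} {q p₁ p₂ : P.Q} {γ γ₁ γ₂ : List P.Γ} {w₁ w₂ t : List T}
    (h₁ : P.Run n q γ w₁ p₁ γ₁) (h₂ : P.Run (n + k) q γ w₂ p₂ γ₂)
    (ht₁ : w₁ <+: t) (ht₂ : w₂ <+: t) :
    ∃ w', w₂ = w₁ ++ w' ∧ P.Run k p₁ γ₁ w' p₂ γ₂ := by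
  induction n generalizing q γ w₁ w₂ t with
  | zero =>
    obtain ⟨rfl, rfl, rfl⟩ := h₁.eq_of_zero
    exact ⟨w₂, rfl, by simpa using h₂⟩
  | succ n ih =>
    rw [Nat.add_right_comm] at h₂
    obtain ⟨a, Z, γ', p, α, w, rfl, rfl, hδ, h₁'⟩ := h₁.exists_of_succ
    obtain ⟨a', Z', γ'', p', α', w', h1, rfl, hδ', h₂'⟩ := h₂.exists_of_succ
    simp only [List.cons.injEq] at h1
    obtain ⟨rfl, rfl⟩ := h1
    have haa : a = a' := by
      cases a with
      | none =>
        cases a' with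
        | none => rfl
        | some b =>
          have := P.det q Z (by simp [hδ]) b
          simp [this] at hδ'
      | some b =>
        cases a' with
        | none =>
          have := P.det q Z (by simp [hδ']) b
          simp [this] at hδ
        | some b' =>
          obtain ⟨s, rfl⟩ := ht₁
          simp at ht₂
          simp [ht₂.1]
    subst haa
    rw [hδ] at hδ'
    simp only [Option.some.injEq, Prod.mk.injEq] at hδ'
    obtain ⟨rfl, rfl⟩ := hδ'
    obtain ⟨s, rfl⟩ := ht₁
    rw [List.append_assoc, List.prefix_append_right_inj] at ht₂
    obtain ⟨w'', rfl, h⟩ := ih h₁' h₂' (List.prefix_append w s) ht₂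
    exact ⟨w'', by simp, h⟩

lemma Run.pop_unique {n m : ℕ} {q r s : P.Q} {γ : List P.Γ} {x y t : List T}
    (h₁ : P.Run n q γ x r []) (h₂ : P.Run m q γ y s []) (hx : x <+: t) (hy : y <+: t) :
    x = y ∧ r = s := by
  wlog hnm : n ≤ m generalizing n m r s x y
  · have := this h₂ h₁ hy hx (by omega)
    exact ⟨this.1.symm, this.2.symm⟩
  obtain ⟨k, rfl⟩ := Nat.exists_eq_add_of_le hnm
  obtain ⟨w', rfl, h⟩ := h₁.det h₂ hx hy
  obtain ⟨-, rfl, rfl, -⟩ := h.eq_of_nil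
  simp

lemma steps_iff_exists_run {q p : P.Q} {w w' : List T} {γ δ : List P.Γ} :
    P.Steps (q, w, γ) (p, w', δ) ↔ ∃ n w₁, w = w₁ ++ w' ∧ P.Run n q γ w₁ p δ := by
  constructor
  · intro h
    generalize hc : (q, w, γ) = c at h
    generalize hc' : (p, w', δ) = c' at h
    induction h generalizing q w γ with
    | refl c =>
      subst hc
      simp only [Prod.mk.injEq] at hc'
      obtain ⟨rfl, rfl, rfl⟩ := hc'
      exact ⟨0, [], rfl, Run.refl _ _⟩
    | step h _ ih =>
      simp only [Prod.mk.injEq] at hc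
      obtain ⟨rfl, rfl, rfl⟩ := hc
      obtain ⟨n, w₁, rfl, hr⟩ := ih rfl hc'
      exact ⟨n + 1, _, by rw [List.append_assoc], Run.step h hr⟩
  · rintro ⟨n, w₁, rfl, h⟩
    induction h with
    | refl => exact Steps.refl _
    | step h _ ih =>
      rw [List.append_assoc]
      exact Steps.step h ih

lemma mem_language_iff_acc {w : List T} : w ∈ P.language ↔ P.Acc P.q₀ [P.Z₀] w := by
  constructor
  · rintro ⟨f, hf, γ, h⟩
    obtain ⟨n, w₁, rfl, h'⟩ := steps_iff_exists_run.1 h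
    exact ⟨n, f, hf, γ, by simpa using h'⟩
  · rintro ⟨n, f, hf, γ, h⟩
    exact ⟨f, hf, γ, steps_iff_exists_run.2 ⟨n, w, by simp, h⟩⟩

lemma Run.acc_append_iff {n : ℕ} {q p : P.Q} {γ δ : List P.Γ} {s z : List T}
    (h : P.Run n q γ s p δ) (hz : z ≠ []) : P.Acc q γ (s ++ z) ↔ P.Acc p δ z := by
  constructor
  · rintro ⟨m, f, hf, ε, h'⟩
    rcases le_total n m with hnm | hnm
    · obtain ⟨k, rfl⟩ := Nat.exists_eq_add_of_le hnm
      obtain ⟨w', hw, h2⟩ := h.det h' (List.prefix_append s z) List.prefix_rfl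
      rw [List.append_cancel_left_eq] at hw
      subst hw
      exact ⟨k, f, hf, ε, h2⟩
    · obtain ⟨k, rfl⟩ := Nat.exists_eq_add_of_le hnm
      obtain ⟨w', hw, -⟩ := h'.det h List.prefix_rfl (List.prefix_append s z)
      have h1 := congrArg List.length hw
      have h2 := List.length_pos_of_ne_nil hz
      simp only [List.length_append] at h1
      omega
  · rintro ⟨m, f, hf, ε, h'⟩
    exact ⟨n + m, f, hf, ε, h.trans h'⟩

lemma acc_append_stack_iff {q : P.Q} {α γ : List P.Γ} {z : List T} :
    P.Acc q (α ++ γ) z ↔ P.Acc q α z ∨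
      ∃ n r z₁ z₂, z = z₁ ++ z₂ ∧ P.Run n q α z₁ r [] ∧ P.Acc r γ z₂ := by
  constructor
  · rintro ⟨n, f, hf, δ, h⟩
    rcases h.split_stack with ⟨δ', rfl, h'⟩ | ⟨n₁, n₂, r, z₁, z₂, rfl, rfl, h1, h2⟩
    · exact Or.inl ⟨n, f, hf, δ', h'⟩
    · exact Or.inr ⟨n₁, r, z₁, z₂, rfl, h1, n₂, f, hf, δ, h2⟩
  · rintro (⟨n, f, hf, δ, h⟩ | ⟨n, r, z₁, z₂, rfl, h, m, f, hf, δ, h'⟩)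
    · exact ⟨n, f, hf, _, h.append γ⟩
    · have := h.append γ
      exact ⟨n + m, f, hf, δ, this.trans h'⟩

lemma acc_append_congr {q : P.Q} {α γ γ' : List P.Γ}
    (h : ∀ r, P.Pop q α r → ∀ z, P.Acc r γ z ↔ P.Acc r γ' z) (z : List T) :
    P.Acc q (α ++ γ) z ↔ P.Acc q (α ++ γ') z := by
  rw [acc_append_stack_iff, acc_append_stack_iff]
  refine or_congr_right ⟨?_, ?_⟩
  · rintro ⟨n, r, z₁, z₂, rfl, h1, h2⟩
    exact ⟨n, r, z₁, z₂, rfl, h1, (h r ⟨n, z₁, h1⟩ z₂).1 h2⟩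
  · rintro ⟨n, r, z₁, z₂, rfl, h1, h2⟩
    exact ⟨n, r, z₁, z₂, rfl, h1, (h r ⟨n, z₁, h1⟩ z₂).2 h2⟩

lemma pop_append_iff {q r : P.Q} {α β : List P.Γ} :
    P.Pop q (α ++ β) r ↔ ∃ s, P.Pop q α s ∧ P.Pop s β r := by
  constructor
  · rintro ⟨n, w, h⟩
    rcases h.split_stack with ⟨δ', h0, h'⟩ | ⟨n₁, n₂, s, w₁, w₂, rfl, rfl, h1, h2⟩
    · rw [eq_comm, List.append_eq_nil_iff] at h0
      obtain ⟨rfl, rfl⟩ := h0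
      exact ⟨r, ⟨n, w, h'⟩, 0, [], Run.refl _ _⟩
    · exact ⟨s, ⟨n₁, w₁, h1⟩, n₂, w₂, h2⟩
  · rintro ⟨s, ⟨n, w, h⟩, m, w', h'⟩
    exact ⟨n + m, w ++ w', Run.trans (by simpa using h.append β) h'⟩

lemma Run.exists_prefix {n : ℕ} {q p : P.Q} {γ δ : List P.Γ} {s z : List T}
    (h : P.Run n q γ (s ++ z) p δ) : ∃ m r ε, P.Run m q γ s r ε := by
  generalize hw : s ++ z = w at h
  induction h generalizing s with
  | refl q γ =>
    simp at hw
    exact ⟨0, q, γ, by simpa [hw.1] using Run.refl q γ⟩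
  | @step n q p r a Z α γ δ w h _ ih =>
    cases s with
    | nil => exact ⟨0, q, _, Run.refl _ _⟩
    | cons b s =>
      cases a with
      | none =>
        obtain ⟨m, r, ε, hr⟩ := ih (s := b :: s) (by simpa using hw)
        exact ⟨m + 1, r, ε, Run.step (a := none) h hr⟩
      | some c =>
        simp at hw
        obtain ⟨rfl, hw⟩ := hw
        obtain ⟨m, r, ε, hr⟩ := ih hw
        exact ⟨m + 1, r, ε, Run.step (a := some b) h hr⟩

lemma Run.pow_push {n : ℕ} {q : P.Q} {A : P.Γ} {β : List P.Γ} {v : List T}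
    (h : P.Run n q [A] v q (A :: β)) (d : ℕ) :
    P.Run (d * n) q [A] (v.pow d) q (A :: β.pow d) := by
  induction d with
  | zero => simpa using Run.refl q [A]
  | succ d ih =>
    have h2 : P.Run (d * n) q (A :: β) (v.pow d) q (A :: (β.pow d ++ β)) := by
      simpa using ih.append β
    rw [List.pow_succ', List.pow_add' β d 1, Nat.succ_mul, Nat.add_comm]
    simpa [List.pow_succ'] using h.trans h2

lemma Run.pow_pop {n : ℕ} {r : P.Q} {β : List P.Γ} {x : List T}
    (h : P.Run n r β x r []) (d : ℕ) :
    P.Run (d * n) r (β.pow d) (x.pow d) r [] := by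
  induction d with
  | zero => simpa using Run.refl r []
  | succ d ih =>
    rw [List.pow_succ', List.pow_succ', Nat.succ_mul, Nat.add_comm]
    exact Run.trans (by simpa using h.append (β.pow d)) ih

lemma acc_pow_succ_iff {p : P.Q} {β γ : List P.Γ} {z : List T} {d : ℕ} :
    P.Acc p (β.pow (d + 1) ++ γ) z ↔ P.Acc p β z ∨
      ∃ n r z₁ z₂, z = z₁ ++ z₂ ∧ P.Run n p β z₁ r [] ∧ P.Acc r (β.pow d ++ γ) z₂ := by
  rw [List.pow_succ', List.append_assoc, acc_append_stack_iff]

lemma acc_pow_eventuallyConst_of_run {n : ℕ} {p r : P.Q} {β γ : List P.Γ} {z₁ z₂ : List T}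
    (h : P.Run n p β z₁ r []) (hr : EventuallyConst fun d => P.Acc r (β.pow d ++ γ) z₂) :
    EventuallyConst fun d => P.Acc p (β.pow d ++ γ) (z₁ ++ z₂) := by
  have key : ∀ d, P.Acc p (β.pow (d + 1) ++ γ) (z₁ ++ z₂) ↔
      P.Acc p β (z₁ ++ z₂) ∨ P.Acc r (β.pow d ++ γ) z₂ := by
    intro d
    rw [acc_pow_succ_iff]
    refine or_congr_right ⟨?_, fun h' => ⟨n, r, z₁, z₂, rfl, h, h'⟩⟩
    rintro ⟨m, s, y₁, y₂, hy, hrun, hacc⟩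
    obtain ⟨rfl, rfl⟩ := h.pop_unique hrun (List.prefix_append z₁ z₂)
      (by rw [hy]; exact List.prefix_append y₁ y₂)
    rw [List.append_cancel_left_eq] at hy
    rwa [hy]
  refine EventuallyConst.of_succ ?_
  obtain ⟨d₀, h₀⟩ := hr
  exact ⟨d₀, fun d hd => ((key d).trans (or_congr_right (h₀ d hd))).trans (key d₀).symm⟩

lemma acc_pow_eventuallyConst {β : List P.Γ}
    (hE : ∀ p r, P.Pop p β r → ∃ s, P.Pop p β s ∧ P.Pop s β r) (γ : List P.Γ) (p : P.Q)
    (z : List T) : EventuallyConst fun d => P.Acc p (β.pow d ++ γ) z := by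
  induction hz : z.length using Nat.strong_induction_on generalizing p z with
  | _ ℓ ih =>
    subst hz
    have base : ∀ p, (∀ n r, ¬ P.Run n p β [] r []) →
        EventuallyConst fun d => P.Acc p (β.pow d ++ γ) z := by
      intro p hp
      by_cases hpop : ∃ n r z₁ z₂, z = z₁ ++ z₂ ∧ P.Run n p β z₁ r []
      · obtain ⟨n, r, z₁, z₂, rfl, hrun⟩ := hpop
        refine acc_pow_eventuallyConst_of_run hrun (ih _ ?_ _ _ rfl)
        have : z₁ ≠ [] := by
          rintro rfl
          exact hp _ _ hrun
        have := List.length_pos_of_ne_nil this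
        simp only [List.length_append]
        omega
      · refine EventuallyConst.of_succ ⟨0, fun d _ => ?_⟩
        beta_reduce
        rw [acc_pow_succ_iff, acc_pow_succ_iff]
        refine or_congr_right (iff_of_false ?_ ?_) <;>
        · rintro ⟨n, r, z₁, z₂, h1, h2, -⟩
          exact hpop ⟨n, r, z₁, z₂, h1, h2⟩
    have loop : ∀ n p, P.Run n p β [] p [] →
        EventuallyConst fun d => P.Acc p (β.pow d ++ γ) z := fun n p hp =>
      EventuallyConst.of_imp_succ fun d hd =>
        acc_pow_succ_iff.2 (Or.inr ⟨n, p, [], z, rfl, hp, hd⟩)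
    by_cases hp : ∃ n r, P.Run n p β [] r []
    · obtain ⟨n, r, hrun⟩ := hp
      refine acc_pow_eventuallyConst_of_run (z₁ := []) hrun ?_
      obtain ⟨s, ⟨m, w, hs⟩, hsr⟩ := hE p r ⟨n, [], hrun⟩
      obtain ⟨-, rfl⟩ := hrun.pop_unique hs List.nil_prefix List.prefix_rfl
      by_cases hr : ∃ n s, P.Run n r β [] s []
      · obtain ⟨m, s, hs'⟩ := hr
        obtain ⟨k, w, hk⟩ := hsr
        obtain ⟨-, rfl⟩ := hs'.pop_unique hk List.nil_prefix List.prefix_rfl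
        exact loop _ _ hs'
      · push Not at hr
        exact base r hr
    · push Not at hp
      exact base p hp

/-- A loop pushing a nonempty amount onto a symbol that can be popped reads a nonempty word. -/
lemma Run.push_ne_nil {n m : ℕ} {q r : P.Q} {A : P.Γ} {β : List P.Γ} {v w : List T}
    (hn : 0 < n) (h : P.Run n q [A] v q (A :: β)) (hpop : P.Run m q [A] w r []) : v ≠ [] := by
  rintro rfl
  rcases le_total n m with hnm | hnm
  · obtain ⟨k, rfl⟩ := Nat.exists_eq_add_of_le hnm
    obtain ⟨w', hw, h1⟩ := h.det hpop (t := w) List.nil_prefix List.prefix_rfl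
    have h2 : P.Run (k + n) q (A :: β) w r β := by
      rw [add_comm]
      simpa using hpop.append β
    simp only [List.nil_append] at hw
    subst hw
    obtain ⟨w'', -, h3⟩ := h1.det h2 (t := w) List.prefix_rfl List.prefix_rfl
    have := h3.eq_of_nil
    omega
  · obtain ⟨k, rfl⟩ := Nat.exists_eq_add_of_le hnm
    obtain ⟨w', hw, h1⟩ := hpop.det h (t := w) List.prefix_rfl List.nil_prefix
    have := h1.eq_of_nil
    exact absurd this.2.2.2 (by simp)

/-- Under the pumping property, a loop `β` with idempotent pop relation does not matter
for acceptance below it. -/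
lemma acc_append_iff_of_loop (hL : P.language.PumpsPowers) {n₀ n₁ : ℕ} {q r p : P.Q} {A : P.Γ}
    {β γ : List P.Γ} {u v : List T} (hu : P.Run n₀ P.q₀ [P.Z₀] u q (A :: γ)) (hn₁ : 0 < n₁)
    (hv : P.Run n₁ q [A] v q (A :: β)) (hw : P.Pop q [A] r)
    (hE : ∀ p r, P.Pop p β r → ∃ s, P.Pop p β s ∧ P.Pop s β r)
    (hrr : P.Pop r β r) (hrp : P.Pop r β p)
    {z : List T} (hz : z ≠ []) : P.Acc p (β ++ γ) z ↔ P.Acc p γ z := by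
  obtain ⟨nw, w, hw⟩ := hw
  obtain ⟨nx, x, hx⟩ := hrr
  obtain ⟨ny, y, hy⟩ := hrp
  by_cases hx0 : x = []
  · subst hx0
    obtain ⟨rfl, rfl⟩ := hx.pop_unique hy List.nil_prefix List.prefix_rfl
    have := (hy.append γ).acc_append_iff hz
    simpa using this
  have hv0 := Run.push_ne_nil hn₁ hv hw
  obtain ⟨D, hD, hpump⟩ := hL.two hv0 hx0
  have hφ : ∀ m d, P.Acc p (β.pow d ++ γ) z ↔
      u ++ v.pow (m + (d + 1)) ++ w ++ x.pow m ++ (y ++ z) ∈ P.language := by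
    intro m d
    rw [mem_language_iff_acc]
    have e1 : P.Run _ P.q₀ [P.Z₀] (u ++ v.pow (m + (d + 1))) q
        ([A] ++ (β.pow (m + (d + 1)) ++ γ)) :=
      hu.trans (by simpa using (hv.pow_push (m + (d + 1))).append γ)
    have e2 : P.Run _ P.q₀ [P.Z₀] (u ++ v.pow (m + (d + 1)) ++ w) r
        (β.pow m ++ (β.pow (d + 1) ++ γ)) :=
      e1.trans (by simpa [List.pow_add'] using hw.append (β.pow (m + (d + 1)) ++ γ))
    have e3 : P.Run _ P.q₀ [P.Z₀] (u ++ v.pow (m + (d + 1)) ++ w ++ x.pow m) r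
        (β ++ (β.pow d ++ γ)) :=
      e2.trans (by simpa [List.pow_succ'] using (hx.pow_pop m).append (β.pow (d + 1) ++ γ))
    have e4 : P.Run _ P.q₀ [P.Z₀] (u ++ v.pow (m + (d + 1)) ++ w ++ x.pow m ++ y) p
        (β.pow d ++ γ) :=
      e3.trans (by simpa using hy.append (β.pow d ++ γ))
    rw [← e4.acc_append_iff hz]
    simp
  have hper : ∀ d j, P.Acc p (β.pow d ++ γ) z ↔ P.Acc p (β.pow (d + j * D) ++ γ) z := by
    intro d j
    constructor
    · obtain ⟨m, hm⟩ := hpump u w (y ++ z) (d + 1)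
      intro h
      have := (hm ((hφ m d).1 h) j).1
      rw [hφ m]
      convert this using 6
      ring
    · obtain ⟨m, hm⟩ := hpump u w (y ++ z) (d + j * D + 1)
      intro h
      have := (hm ((hφ m _).1 h) j).2
      rw [hφ (m + j * D)]
      convert this using 6
      ring
  obtain ⟨d₀, h₀⟩ := acc_pow_eventuallyConst hE γ p z
  beta_reduce at h₀
  have hle : d₀ ≤ d₀ * D := Nat.le_mul_of_pos_right _ hD
  have h1 := hper 1 d₀
  have h2 := hper 0 d₀
  rw [h₀ (1 + d₀ * D) (by omega)] at h1
  rw [h₀ (0 + d₀ * D) (by omega)] at h2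
  simpa [List.pow_succ'] using h1.trans h2.symm

/-- The moves available to `P` push at most `B` symbols. -/
def PushBound (P : DPDA T) (B : ℕ) : Prop :=
  ∀ q a Z p α, P.δ q a Z = some (p, α) → α.length ≤ B

/-- Time `n₁` is a stair of a computation of `n` moves reading `s` and ending in `(q', δ)`: the
stack is then `A :: γ`, the state is `q`, and `γ` is not touched afterwards. -/
def Stair (P : DPDA T) (n : ℕ) (s : List T) (q' : P.Q) (δ : List P.Γ)
    (n₁ : ℕ) (q : P.Q) (A : P.Γ) (γ : List P.Γ) : Prop :=
  ∃ w₁ n₂ w₂ α, n = n₁ + n₂ ∧ s = w₁ ++ w₂ ∧ δ = α ++ γ ∧ P.Run n₁ P.q₀ [P.Z₀] w₁ q (A :: γ) ∧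
    P.Run n₂ q [A] w₂ q' α

lemma Run.exists_stair {B : ℕ} (hB : P.PushBound B) {n : ℕ} {s : List T} {q' : P.Q}
    {δ : List P.Γ} (h : P.Run n P.q₀ [P.Z₀] s q' δ) {ℓ : ℕ} (h1 : 1 ≤ ℓ) (hℓ : ℓ < δ.length) :
    ∃ n₁ q A γ, P.Stair n s q' δ n₁ q A γ ∧ γ.length + 1 ≤ ℓ ∧ ℓ < γ.length + B := by
  induction n generalizing s q' δ with
  | zero =>
    obtain ⟨-, -, rfl⟩ := h.eq_of_zero
    simp at hℓ
    omega
  | succ n ih =>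
    obtain ⟨r, ε, w₁, w₂, rfl, hr, hs⟩ := h.split
    obtain ⟨a, Z, γ', p, α, w', rfl, rfl, hδ, h0⟩ := Run.exists_of_succ (n := 0) hs
    obtain ⟨rfl, rfl, rfl⟩ := h0.eq_of_zero
    have hα := hB _ _ _ _ _ hδ
    rw [List.length_append] at hℓ
    by_cases hle : γ'.length + 1 ≤ ℓ
    · refine ⟨n, r, Z, γ', ⟨w₁, 1, _, α, rfl, rfl, rfl, hr, ?_⟩, hle, by omega⟩
      exact Run.step (n := 0) hδ (by simpa using Run.refl _ _)
    · obtain ⟨n₁, q, A, γ, ⟨u₁, n₂, u₂, α', rfl, rfl, he, hr1, hr2⟩, h3, h4⟩ :=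
        ih hr (by simp; omega)
      cases α' with
      | nil =>
        have := congrArg List.length he
        simp at this
        omega
      | cons Z' α'' =>
        simp only [List.cons_append, List.cons.injEq] at he
        obtain ⟨rfl, rfl⟩ := he
        refine ⟨n₁, q, A, γ, ⟨u₁, n₂ + 1, u₂ ++ (a.toList ++ []), α ++ α'', by omega, by simp,
          by simp, hr1, hr2.trans ?_⟩, h3, h4⟩
        exact Run.step (n := 0) hδ (Run.refl _ _)

lemma Stair.link {n : ℕ} {s : List T} {q' : P.Q} {δ : List P.Γ} {n₁ n₂ : ℕ} {q₁ q₂ : P.Q}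
    {A₁ A₂ : P.Γ} {γ₁ γ₂ : List P.Γ} (h₁ : P.Stair n s q' δ n₁ q₁ A₁ γ₁)
    (h₂ : P.Stair n s q' δ n₂ q₂ A₂ γ₂) (hle : n₁ ≤ n₂) (hδ : γ₁.length < δ.length) :
    ∃ κ v, A₂ :: γ₂ = κ ++ γ₁ ∧ P.Run (n₂ - n₁) q₁ [A₁] v q₂ κ := by
  obtain ⟨w₁, m₁, x₁, α₁, rfl, rfl, rfl, hr₁, hs₁⟩ := h₁
  obtain ⟨w₂, m₂, x₂, α₂, hn, hw, hd, hr₂, hs₂⟩ := h₂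
  obtain ⟨k, rfl⟩ := Nat.exists_eq_add_of_le hle
  obtain ⟨v, rfl, hr⟩ := hr₁.det hr₂ (List.prefix_append w₁ x₁)
    (by rw [hw]; exact List.prefix_append w₂ x₂)
  rw [List.append_assoc, List.append_cancel_left_eq] at hw
  rw [Nat.add_sub_cancel_left]
  rcases Run.split_stack (α := [A₁]) hr with ⟨κ, h1, h2⟩ | ⟨k₁, k₂, r, v₁, v₂, rfl, rfl, h1, h2⟩
  · exact ⟨κ, v, h1, h2⟩
  · obtain ⟨k', rfl⟩ : ∃ k', m₁ = k₁ + k' := ⟨k₂ + m₂, by omega⟩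
    obtain ⟨v', -, h3⟩ := h1.det hs₁ (t := x₁) (by rw [hw, List.append_assoc]; simp)
      List.prefix_rfl
    obtain ⟨-, -, -, rfl⟩ := h3.eq_of_nil
    simp at hδ

lemma Stair.lt {n : ℕ} {s : List T} {q' : P.Q} {δ : List P.Γ} {n₁ n₂ : ℕ} {q₁ q₂ : P.Q}
    {A₁ A₂ : P.Γ} {γ₁ γ₂ : List P.Γ} (h₁ : P.Stair n s q' δ n₁ q₁ A₁ γ₁)
    (h₂ : P.Stair n s q' δ n₂ q₂ A₂ γ₂) (hδ : γ₂.length < δ.length)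
    (hlt : γ₁.length + 2 ≤ γ₂.length) : n₁ < n₂ := by
  by_contra! hle
  obtain ⟨κ, v, h, -⟩ := h₂.link h₁ hle hδ
  have := congrArg List.length h
  simp at this
  omega

lemma Stair.exists_loop {n : ℕ} {s : List T} {q' : P.Q} {δ : List P.Γ} {n₁ n₂ : ℕ}
    {q₁ q₂ : P.Q} {A₁ A₂ : P.Γ} {γ₁ γ₂ : List P.Γ} (h₁ : P.Stair n s q' δ n₁ q₁ A₁ γ₁)
    (h₂ : P.Stair n s q' δ n₂ q₂ A₂ γ₂) (hδ : γ₂.length < δ.length)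
    (hlt : γ₁.length + 2 ≤ γ₂.length) :
    ∃ β v, γ₂ = β ++ γ₁ ∧ P.Run (n₂ - n₁) q₁ [A₁] v q₂ (A₂ :: β) := by
  obtain ⟨κ, v, h, hr⟩ := h₁.link h₂ (h₁.lt h₂ hδ hlt).le (by omega)
  cases κ with
  | nil =>
    have := congrArg List.length h
    simp at this
    omega
  | cons Z β =>
    simp only [List.cons_append, List.cons.injEq] at h
    obtain ⟨rfl, rfl⟩ := h
    exact ⟨β, v, rfl, hr⟩

/-- Under the pumping property, a configuration with a large stack is equivalent to one
that can be reached in fewer moves. -/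
lemma exists_shorter_run (hL : P.language.PumpsPowers) {B : ℕ} (hB : P.PushBound B) :
    ∃ H : ℕ, ∀ n s q' δ, P.Run n P.q₀ [P.Z₀] s q' δ → H < δ.length →
      ∃ n' s' δ', n' < n ∧ P.Run n' P.q₀ [P.Z₀] s' q' δ' ∧
        ∀ z, P.Acc q' δ z ↔ P.Acc q' δ' z := by
  classical
  have : Nonempty P.Q := ⟨P.q₀⟩
  have : Nonempty P.Γ := ⟨P.Z₀⟩
  let I := P.Q × P.Γ × Set P.Q
  let K := I × I × Set (P.Q × P.Q)
  have : Finite K := inferInstance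
  have : Fintype K := Fintype.ofFinite K
  obtain ⟨N, hN⟩ := exists_monochromatic_triangle (K := K) (Finset.univ : Finset K).card
  refine ⟨1 + N * (B + 2), fun n s q' δ hrun hδ => ?_⟩
  have hst : ∀ e, e < N → ∃ n₁ q A γ, P.Stair n s q' δ n₁ q A γ ∧
      γ.length + 1 ≤ 1 + e * (B + 2) ∧ 1 + e * (B + 2) < γ.length + B := by
    intro e he
    have : e * (B + 2) ≤ N * (B + 2) := Nat.mul_le_mul_right _ he.le
    exact hrun.exists_stair hB (by omega) (by omega)
  choose! t q A γ hst hlow hhigh using hst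
  have hlen : ∀ i j, i < j → j < N → (γ i).length + 2 ≤ (γ j).length := by
    intro i j hij hj
    have h1 := hlow i (by omega)
    have h2 := hhigh j hj
    have h3 : (i + 1) * (B + 2) ≤ j * (B + 2) := Nat.mul_le_mul_right _ hij
    rw [Nat.succ_mul] at h3
    omega
  have hlenδ : ∀ i, i < N → (γ i).length < δ.length := by
    intro i hi
    have h1 := hlow i hi
    have h3 : i * (B + 2) ≤ N * (B + 2) := Nat.mul_le_mul_right _ hi.le
    omega
  let info : ℕ → I := fun i => (q i, A i, {p | P.Acc p (γ i) []})
  let col : ℕ → ℕ → K := fun i j => (info i, info j,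
    {x | P.Pop x.1 ((γ j).take ((γ j).length - (γ i).length)) x.2})
  have hcol : ∀ i j β, γ j = β ++ γ i →
      (col i j).2.2 = {x | P.Pop x.1 β x.2} := by
    intro i j β h
    simp [col, h]
  obtain ⟨i, -, j, hj, k, hk, hij, hjk, h1, h2⟩ := hN col Finset.univ le_rfl (Finset.range N)
    (by simp) (by simp)
  rw [Finset.mem_range] at hj hk
  obtain ⟨β, v, hβ, hv⟩ := (hst i (by omega)).exists_loop (hst j hj) (hlenδ j hj)
    (hlen i j hij hj)
  obtain ⟨β', v', hβ', hv'⟩ := (hst j hj).exists_loop (hst k hk) (hlenδ k hk)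
    (hlen j k hjk hk)
  have hpos : 0 < t j - t i :=
    Nat.sub_pos_of_lt ((hst i (by omega)).lt (hst j hj) (hlenδ j hj) (hlen i j hij hj))
  have e1 : ∀ p r, P.Pop p β r ↔ P.Pop p β' r := by
    intro p r
    have := congrArg (fun x => (p, r) ∈ x.2.2) h1
    simpa [hcol _ _ _ hβ, hcol _ _ _ hβ'] using this
  have e2 : ∀ p r, P.Pop p (β' ++ β) r ↔ P.Pop p β r := by
    intro p r
    rw [e1]
    have := congrArg (fun x => (p, r) ∈ x.2.2) h2
    simpa [hcol i k (β' ++ β) (by simp [hβ', hβ]), hcol _ _ _ hβ'] using this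
  have hinfo : info i = info j := congrArg (fun x => x.1) h1
  have hq : q i = q j := congrArg (fun x => x.1) hinfo
  have hA : A i = A j := congrArg (fun x => x.2.1) hinfo
  have hnil : ∀ p, P.Acc p (γ i) [] ↔ P.Acc p (γ j) [] := by
    intro p
    have := congrArg (fun x => p ∈ x.2.2) hinfo
    simpa [info] using this
  rw [hq, hA] at hv
  obtain ⟨w₁, m₁, x₁, α₁, -, -, -, hr₁, -⟩ := hst i (by omega)
  obtain ⟨w₂, m₂, x₂, α₂, hn₂, -, hδ₂, hr₂, hs₂⟩ := hst j hj
  obtain ⟨w₃, m₃, x₃, α₃, -, -, hδ₃, -, -⟩ := hst k hk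
  have hα : α₂ = α₃ ++ β' := by
    rw [hδ₂, hβ', ← List.append_assoc, List.append_cancel_right_eq] at hδ₃
    exact hδ₃
  rw [hq, hA] at hr₁
  refine ⟨t i + m₂, w₁ ++ x₂, α₂ ++ γ i, by omega,
    hr₁.trans (by simpa using hs₂.append (γ i)), fun z => ?_⟩
  rw [hδ₂]
  refine acc_append_congr (fun p hp z => ?_) z
  rcases eq_or_ne z [] with rfl | hz
  · exact (hnil p).symm
  rw [hβ]
  rw [hα, pop_append_iff] at hp
  obtain ⟨p₀, hp₀, hp⟩ := hp
  rw [← e1] at hp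
  have hdense : ∀ x y, P.Pop x β y → ∃ s, P.Pop x β s ∧ P.Pop s β y := by
    intro x y hxy
    rw [← e2, pop_append_iff] at hxy
    simpa only [e1] using hxy
  have htrans : ∀ x y z, P.Pop x β y → P.Pop y β z → P.Pop x β z := by
    intro x y z hxy hyz
    rw [← e2, pop_append_iff]
    exact ⟨y, (e1 _ _).1 hxy, hyz⟩
  obtain ⟨r, h3, h4, h5⟩ := exists_refl_between htrans hdense hp
  refine acc_append_iff_of_loop hL hr₁ hpos hv ?_ hdense h4 h5 hz
  have hpop : P.Pop q' α₂ r := by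
    rw [hα, pop_append_iff]
    exact ⟨p₀, hp₀, (e1 _ _).1 h3⟩
  obtain ⟨m, y, hy⟩ := hpop
  exact ⟨_, _, hs₂.trans hy⟩

lemma isRegular_of_pumpsPowers_of_pushBound (hL : P.language.PumpsPowers) {B : ℕ}
    (hB : P.PushBound B) : P.language.IsRegular := by
  classical
  obtain ⟨H, hH⟩ := exists_shorter_run hL hB
  have key : ∀ n s q δ, P.Run n P.q₀ [P.Z₀] s q δ →
      ∃ δ' : List P.Γ, δ'.length ≤ H ∧ ∀ z, P.Acc q δ z ↔ P.Acc q δ' z := by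
    intro n
    induction n using Nat.strong_induction_on with
    | _ n ih =>
      intro s q δ h
      by_cases hδ : δ.length ≤ H
      · exact ⟨δ, hδ, fun z => Iff.rfl⟩
      · obtain ⟨n', s', δ', hn, hr, he⟩ := hH n s q δ h (by omega)
        obtain ⟨δ'', h1, h2⟩ := ih n' hn s' q δ' hr
        exact ⟨δ'', h1, fun z => (he z).trans (h2 z)⟩
  rw [Language.isRegular_iff_finite_range_leftQuotient]
  let S : Set (P.Q × List P.Γ × Prop) :=
    Set.univ ×ˢ ({δ | δ.length ≤ H} ×ˢ Set.univ)
  have hS : S.Finite :=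
    Set.finite_univ.prod ((List.finite_length_le P.Γ H).prod Set.finite_univ)
  let F : P.Q × List P.Γ × Prop → Language T := fun c =>
    {z | (z ≠ [] ∧ P.Acc c.1 c.2.1 z) ∨ (z = [] ∧ c.2.2)}
  refine ((hS.image F).union (Set.finite_singleton (∅ : Set (List T)))).subset ?_
  rintro _ ⟨s, rfl⟩
  by_cases hs : ∃ n q δ, P.Run n P.q₀ [P.Z₀] s q δ
  · left
    obtain ⟨n, q, δ, hr⟩ := hs
    obtain ⟨δ', h1, h2⟩ := key n s q δ hr
    refine ⟨(q, δ', s ∈ P.language), ⟨trivial, h1, trivial⟩, ?_⟩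
    apply Set.ext
    intro z
    change _ ↔ s ++ z ∈ P.language
    change (z ≠ [] ∧ P.Acc q δ' z) ∨ (z = [] ∧ s ∈ P.language) ↔ _
    rcases eq_or_ne z [] with rfl | hz
    · simp
    · rw [mem_language_iff_acc (w := s ++ z), hr.acc_append_iff hz, h2]
      simp [hz]
  · right
    apply Set.ext
    intro z
    refine iff_of_false (fun hz => hs ?_) (by simp)
    obtain ⟨n, f, -, ε, hr⟩ := mem_language_iff_acc.1 (show s ++ z ∈ P.language from hz)
    exact hr.exists_prefix

/-- The automaton obtained by removing all moves that read a letter outside `T₀`. -/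
noncomputable def restrict (P : DPDA T) (T₀ : Set T) : DPDA T where
  Q := P.Q
  Γ := P.Γ
  fQ := P.fQ
  fΓ := P.fΓ
  δ q a Z := by
    classical
    exact if ∀ b ∈ a, b ∈ T₀ then P.δ q a Z else none
  det q Z h a := by
    have := P.det q Z (by simpa using h) a
    simp [this]
  q₀ := P.q₀
  Z₀ := P.Z₀
  F := P.F

lemma restrict_δ_eq_some {T₀ : Set T} {q p : P.Q} {a : Option T} {Z : P.Γ} {α : List P.Γ} :
    (P.restrict T₀).δ q a Z = some (p, α) ↔ (∀ b ∈ a, b ∈ T₀) ∧ P.δ q a Z = some (p, α) := by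
  classical
  change (if ∀ b ∈ a, b ∈ T₀ then P.δ q a Z else none) = some (p, α) ↔ _
  split_ifs with h
  · exact ⟨fun h' => ⟨h, h'⟩, fun h' => h'.2⟩
  · exact ⟨fun h' => by simp at h', fun h' => absurd h'.1 h⟩

lemma Run.of_restrict {T₀ : Set T} {n : ℕ} {q p : (P.restrict T₀).Q}
    {γ δ : List (P.restrict T₀).Γ} {w : List T} (h : (P.restrict T₀).Run n q γ w p δ) :
    (∀ b ∈ w, b ∈ T₀) ∧ P.Run n q γ w p δ := by
  induction h with
  | refl q γ => exact ⟨by simp, Run.refl (P := P) q γ⟩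
  | step h _ ih =>
    obtain ⟨h1, h2⟩ := restrict_δ_eq_some.1 h
    refine ⟨fun b hb => ?_, Run.step h2 ih.2⟩
    rcases List.mem_append.1 hb with hb | hb
    · exact h1 b (by simpa using hb)
    · exact ih.1 b hb

lemma run_restrict_iff {T₀ : Set T} {n : ℕ} {q p : P.Q} {γ δ : List P.Γ} {w : List T} :
    (P.restrict T₀).Run n q γ w p δ ↔ (∀ b ∈ w, b ∈ T₀) ∧ P.Run n q γ w p δ := by
  constructor
  · exact Run.of_restrict
  · rintro ⟨h0, h⟩
    induction h with
    | refl q γ => exact Run.refl (P := P.restrict T₀) q γ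
    | step h _ ih =>
      refine Run.step (P := P.restrict T₀) (restrict_δ_eq_some.2 ⟨fun b hb => ?_, h⟩)
        (ih fun b hb => h0 b (List.mem_append_right _ hb))
      exact h0 b (List.mem_append_left _ (by simpa using hb))

lemma restrict_language {T₀ : Set T} (h : ∀ w ∈ P.language, ∀ b ∈ w, b ∈ T₀) :
    (P.restrict T₀).language = P.language := by
  apply Set.ext
  intro w
  change w ∈ (P.restrict T₀).language ↔ w ∈ P.language
  constructor
  · intro hw
    obtain ⟨n, f, hf, δ, hr⟩ := mem_language_iff_acc.1 hw
    exact mem_language_iff_acc.2 ⟨n, f, hf, δ, (run_restrict_iff.1 hr).2⟩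
  · intro hw
    obtain ⟨n, f, hf, δ, hr⟩ := mem_language_iff_acc.1 hw
    exact mem_language_iff_acc.2 ⟨n, f, hf, δ, run_restrict_iff.2 ⟨h w hw, hr⟩⟩

lemma exists_pushBound_restrict {T₀ : Set T} (hT₀ : T₀.Finite) :
    ∃ B, (P.restrict T₀).PushBound B := by
  classical
  let S : Set (P.Q × Option T × P.Γ) := Set.univ ×ˢ (insert none (some '' T₀)) ×ˢ Set.univ
  have hS : S.Finite :=
    Set.finite_univ.prod (((hT₀.image some).insert none).prod Set.finite_univ)
  let F : P.Q × Option T × P.Γ → ℕ := fun x => ((P.δ x.1 x.2.1 x.2.2).map (·.2.length)).getD 0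
  obtain ⟨B, hB⟩ := (hS.image F).bddAbove
  refine ⟨B, fun q a Z p α h => ?_⟩
  obtain ⟨h1, h2⟩ := restrict_δ_eq_some.1 h
  have h3 : F (q, a, Z) = α.length := by
    simp only [F, h2, Option.map_some, Option.getD_some]
    rfl
  refine (le_of_eq h3.symm).trans (hB ⟨(q, a, Z), ⟨trivial, ?_, trivial⟩, rfl⟩)
  · cases a with
    | none => simp
    | some b => simpa using h1 b (by simp)

/-- A deterministic context-free language over a finite set of letters with the pumping
property is regular. -/
theorem isRegular_of_pumpsPowers (hL : P.language.PumpsPowers) {T₀ : Set T} (hT₀ : T₀.Finite)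
    (h : ∀ w ∈ P.language, ∀ b ∈ w, b ∈ T₀) : P.language.IsRegular := by
  obtain ⟨B, hB⟩ := exists_pushBound_restrict (P := P) hT₀
  rw [← restrict_language h] at hL ⊢
  exact isRegular_of_pumpsPowers_of_pushBound hL hB

end DPDA

namespace ContextFreeGrammar

variable {T : Type} {g : ContextFreeGrammar T}

/-- `g.Path A y C`: using only rules of the form `A → wB`, the nonterminal `A` derives `yC`. -/
inductive Path (g : ContextFreeGrammar T) : g.NT → List T → g.NT → Prop
  | refl (A : g.NT) : Path g A [] A
  | step {r : ContextFreeRule T g.NT} {w y : List T} {B C : g.NT} (hr : r ∈ g.rules)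
      (ho : r.output = w.map Symbol.terminal ++ [Symbol.nonterminal B]) (h : Path g B y C) :
      Path g r.input (w ++ y) C

lemma Path.trans {A B C : g.NT} {y z : List T} (h : g.Path A y B) (h' : g.Path B z C) :
    g.Path A (y ++ z) C := by
  induction h with
  | refl => exact h'
  | step hr ho _ ih =>
    rw [List.append_assoc]
    exact Path.step hr ho (ih h')

lemma Path.pow {A : g.NT} {y : List T} (h : g.Path A y A) (n : ℕ) : g.Path A (y.pow n) A := by
  induction n with
  | zero => exact Path.refl A
  | succ n ih => exact h.trans ih

lemma produces_cons {r : ContextFreeRule T g.NT} (hr : r ∈ g.rules)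
    (s : List (Symbol T g.NT)) : g.Produces (.nonterminal r.input :: s) (r.output ++ s) :=
  ⟨r, hr, ContextFreeRule.Rewrites.head s⟩

lemma Path.derives {A B : g.NT} {y : List T} (h : g.Path A y B) (s : List (Symbol T g.NT)) :
    g.Derives (.nonterminal A :: s) (y.map .terminal ++ .nonterminal B :: s) := by
  induction h with
  | refl => exact Derives.refl _
  | @step r w y B C hr ho _ ih =>
    refine (produces_cons hr s).trans_derives ?_
    rw [ho]
    simpa using ih.append_left (w.map .terminal)

/-- The sequence of nonterminals visited by a path, with the positions at which this happens. -/
lemma Path.exists_trace {R : ℕ} (hR : ∀ r ∈ g.rules, r.output.length ≤ R) {A C : g.NT}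
    {y : List T} (h : g.Path A y C) :
    ∃ (n : ℕ) (X : ℕ → g.NT) (p : ℕ → ℕ), p 0 = 0 ∧ p n = y.length ∧ X 0 = A ∧ X n = C ∧
      (∀ t < n, ∃ r ∈ g.rules, r.input = X t) ∧
      (∀ t < n, p t ≤ p (t + 1) ∧ p (t + 1) ≤ p t + R) ∧
      ∀ s t, s ≤ t → t ≤ n → g.Path (X s) ((y.take (p t)).drop (p s)) (X t) := by
  induction h with
  | refl A =>
    refine ⟨0, fun _ => A, fun _ => 0, rfl, rfl, rfl, rfl, by simp, by simp, ?_⟩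
    intro s t _ _
    exact Path.refl A
  | @step r w y B C hr ho _ ih =>
    obtain ⟨n, X, p, h1, h2, h3, h4, h5, h6, h7⟩ := ih
    have hw : w.length ≤ R := by
      have := hR r hr
      rw [ho] at this
      simp at this
      omega
    refine ⟨n + 1, fun t => t.casesOn r.input X, fun t => t.casesOn 0 fun t => w.length + p t,
      rfl, by simp [h2], rfl, h4, ?_, ?_, ?_⟩
    · rintro (_ | t) ht
      · exact ⟨r, hr, rfl⟩
      · exact h5 t (by omega)
    · rintro (_ | t) ht
      · simpa [h1] using hw
      · have := h6 t (by omega)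
        dsimp only
        omega
    · rintro (_ | s) (_ | t) hst ht
      · exact Path.refl _
      · have := h7 0 t (by omega) (by omega)
        rw [h1, h3] at this
        simpa [List.take_length_add_append] using Path.step hr ho this
      · omega
      · have := h7 s t (by omega) (by omega)
        have hd : w.drop (w.length + p s) = [] := List.drop_eq_nil_of_le (by omega)
        simpa [List.take_length_add_append, List.drop_append, hd] using this

/-- Pumping lemma for paths. -/
lemma Path.exists_pump {R : ℕ} (hR : ∀ r ∈ g.rules, r.output.length ≤ R) {N : ℕ} (hN : 0 < N) :
    ∃ K > 0, ∀ (A C : g.NT) (y : List T), g.Path A y C → ∀ i, i + K ≤ y.length →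
      ∃ a x b X, y = a ++ x ++ b ∧ i ≤ a.length ∧ a.length + x.length ≤ i + K ∧ x ≠ [] ∧
        N ∣ x.length ∧ g.Path A a X ∧ g.Path X x X ∧ g.Path X b C := by
  classical
  let I : Finset g.NT := g.rules.image ContextFreeRule.input
  set M := (I ×ˢ Finset.range N).card + 1 with hM
  refine ⟨M * (R + 1), by positivity, fun A C y h i hi => ?_⟩
  obtain ⟨n, X, p, h1, h2, h3, h4, h5, h6, h7⟩ := h.exists_trace hR
  have hmono : ∀ s t, s ≤ t → t ≤ n → p s ≤ p t := by
    intro s t hst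
    induction t, hst using Nat.le_induction with
    | base => intro _; exact le_rfl
    | succ t _ ih => intro ht; exact (ih (by omega)).trans (h6 t (by omega)).1
  have hpos : ∀ e, e < M → ∃ t < n, i + e * (R + 1) ≤ p t ∧ p t ≤ i + e * (R + 1) + R := by
    intro e he
    have he' : (e + 1) * (R + 1) ≤ M * (R + 1) := Nat.mul_le_mul_right _ he
    rw [Nat.succ_mul] at he'
    have hex : ∃ t, i + e * (R + 1) ≤ p t := ⟨n, by omega⟩
    have hspec := Nat.find_spec hex
    set t := Nat.find hex with ht
    have htn : t ≤ n := Nat.find_min' hex (by omega)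
    have hle : p t ≤ i + e * (R + 1) + R := by
      rcases Nat.eq_zero_or_eq_succ_pred t with h0 | h0
      · rw [h0, h1]
        omega
      · have := Nat.find_min hex (m := t.pred) (by omega)
        have := (h6 t.pred (by omega)).2
        rw [← Nat.succ_eq_add_one, ← h0] at this
        omega
    refine ⟨t, lt_of_le_of_ne htn ?_, hspec, hle⟩
    rintro h0
    rw [h0, h2] at hle
    omega
  choose! t htn hlow hhigh using hpos
  have hmap : ∀ e ∈ Finset.range M, (X (t e), p (t e) % N) ∈ I ×ˢ Finset.range N := by
    intro e he
    rw [Finset.mem_range] at he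
    simp only [Finset.mem_product, Finset.mem_range]
    obtain ⟨r, hr, hrX⟩ := h5 (t e) (htn e he)
    exact ⟨Finset.mem_image.2 ⟨r, hr, hrX⟩, Nat.mod_lt _ hN⟩
  obtain ⟨e, he, f, hf, hef, heq⟩ := Finset.exists_ne_map_eq_of_card_lt_of_maps_to
    (by simp [hM]) hmap
  wlog hlt : e < f generalizing e f
  · exact this f hf e he hef.symm heq.symm (by omega)
  rw [Finset.mem_range] at he hf
  simp only [Prod.mk.injEq] at heq
  obtain ⟨hX, hmod⟩ := heq
  have hstep : (e + 1) * (R + 1) ≤ f * (R + 1) := Nat.mul_le_mul_right _ hlt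
  have hf' : (f + 1) * (R + 1) ≤ M * (R + 1) := Nat.mul_le_mul_right _ hf
  rw [Nat.succ_mul] at hstep hf'
  have a1 := hlow e he
  have a2 := hhigh e he
  have a3 := hlow f hf
  have a4 := hhigh f hf
  have a5 := hmono (t f) n (htn f hf).le le_rfl
  have htef : t e ≤ t f := by
    by_contra! hcon
    have := hmono _ _ hcon.le (htn e he).le
    omega
  have hlen : ((y.take (p (t f))).drop (p (t e))).length = p (t f) - p (t e) := by
    simp
    omega
  refine ⟨y.take (p (t e)), (y.take (p (t f))).drop (p (t e)), y.drop (p (t f)), X (t e),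
    ?_, ?_, ?_, ?_, ?_, ?_, ?_, ?_⟩
  · conv_lhs => rw [← List.take_append_drop (p (t f)) y,
      ← List.take_append_drop (p (t e)) (y.take (p (t f)))]
    rw [List.take_take, min_eq_left (by omega)]
  · rw [List.length_take]
    omega
  · rw [hlen, List.length_take]
    omega
  · intro h0
    rw [h0, List.length_nil] at hlen
    omega
  · rw [hlen]
    exact (Nat.modEq_iff_dvd' (by omega)).1 hmod
  · simpa [h1, h3] using h7 0 (t e) (by omega) (htn e he).le
  · simpa [hX] using h7 (t e) (t f) htef (htn f hf).le
  · have := h7 (t f) n (htn f hf).le le_rfl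
    rw [h2, h4, List.take_length, ← hX] at this
    exact this

/-- `g.Forest s w k`: the sentential form `s` derives the word `w` by a forest in which all but
`k` rules are grouped into maximal right-linear paths. -/
inductive Forest (g : ContextFreeGrammar T) : List (Symbol T g.NT) → List T → ℕ → Prop
  | nil : Forest g [] [] 0
  | term (a : T) {s : List (Symbol T g.NT)} {w : List T} {k : ℕ} (h : Forest g s w k) :
      Forest g (.terminal a :: s) (a :: w) k
  | leaf {A : g.NT} {r : ContextFreeRule T g.NT} {y z : List T} {s : List (Symbol T g.NT)}
      {w : List T} {k : ℕ} (hp : g.Path A y r.input) (hr : r ∈ g.rules)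
      (ho : r.output = z.map .terminal) (h : Forest g s w k) :
      Forest g (.nonterminal A :: s) (y ++ z ++ w) k
  | node {A : g.NT} {r : ContextFreeRule T g.NT} {y z : List T} {s : List (Symbol T g.NT)}
      {w : List T} {k₁ k₂ : ℕ} (hp : g.Path A y r.input) (hr : r ∈ g.rules)
      (ho : Forest g r.output z k₁) (h : Forest g s w k₂) :
      Forest g (.nonterminal A :: s) (y ++ z ++ w) (k₁ + k₂ + 1)

lemma Derives.append {s₁ s₂ t₁ t₂ : List (Symbol T g.NT)} (h₁ : g.Derives s₁ t₁)
    (h₂ : g.Derives s₂ t₂) : g.Derives (s₁ ++ s₂) (t₁ ++ t₂) :=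
  (h₁.append_right s₂).trans (h₂.append_left t₁)

lemma Path.derives_append {A : g.NT} {r : ContextFreeRule T g.NT} {y z w : List T}
    {s : List (Symbol T g.NT)} (hp : g.Path A y r.input) (hr : r ∈ g.rules)
    (ho : g.Derives r.output (z.map .terminal)) (h : g.Derives s (w.map .terminal)) :
    g.Derives (.nonterminal A :: s) ((y ++ z ++ w).map .terminal) := by
  refine (hp.derives s).trans ?_
  rw [List.append_assoc, List.map_append]
  refine Derives.append_left ?_ _
  rw [List.map_append]
  exact (produces_cons hr s).trans_derives (ho.append h)

lemma Forest.derives {s : List (Symbol T g.NT)} {w : List T} {k : ℕ} (h : g.Forest s w k) :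
    g.Derives s (w.map .terminal) := by
  induction h with
  | nil => exact Derives.refl _
  | term a _ ih => exact ih.append_left [.terminal a]
  | leaf hp hr ho _ ih => exact hp.derives_append hr (by rw [ho]) ih
  | node hp hr _ _ ih₁ ih₂ => exact hp.derives_append hr ih₁ ih₂

lemma Forest.of_terminals (w : List T) : g.Forest (w.map .terminal) w 0 := by
  induction w with
  | nil => exact Forest.nil
  | cons a w ih => exact Forest.term a ih

lemma Forest.append {s₁ s₂ : List (Symbol T g.NT)} {w₁ w₂ : List T} {k₁ k₂ : ℕ}
    (h₁ : g.Forest s₁ w₁ k₁) (h₂ : g.Forest s₂ w₂ k₂) :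
    g.Forest (s₁ ++ s₂) (w₁ ++ w₂) (k₁ + k₂) := by
  induction h₁ with
  | nil => simpa using h₂
  | term a _ ih => exact Forest.term a ih
  | leaf hp hr ho _ ih =>
    rw [List.append_assoc]
    exact Forest.leaf hp hr ho ih
  | node hp hr ho _ _ ih =>
    rw [List.append_assoc, show ∀ a b c : ℕ, a + b + 1 + c = a + (b + c) + 1 by omega]
    exact Forest.node hp hr ho ih

lemma Forest.split {s₁ s₂ : List (Symbol T g.NT)} {w : List T} {k : ℕ}
    (h : g.Forest (s₁ ++ s₂) w k) :
    ∃ w₁ w₂ k₁ k₂, w = w₁ ++ w₂ ∧ k = k₁ + k₂ ∧ g.Forest s₁ w₁ k₁ ∧ g.Forest s₂ w₂ k₂ := by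
  induction s₁ generalizing w k with
  | nil => exact ⟨[], w, 0, k, rfl, by simp, Forest.nil, h⟩
  | cons x s₁ ih =>
    rw [List.cons_append] at h
    cases h with
    | term a h =>
      obtain ⟨w₁, w₂, k₁, k₂, rfl, rfl, h1, h2⟩ := ih h
      exact ⟨a :: w₁, w₂, k₁, k₂, rfl, rfl, Forest.term a h1, h2⟩
    | leaf hp hr ho h =>
      obtain ⟨w₁, w₂, k₁, k₂, rfl, rfl, h1, h2⟩ := ih h
      exact ⟨_, w₂, k₁, k₂, by simp, rfl, Forest.leaf hp hr ho h1, h2⟩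
    | node hp hr ho h =>
      obtain ⟨w₁, w₂, k₁, k₂, rfl, rfl, h1, h2⟩ := ih h
      exact ⟨_, w₂, _, k₂, by simp, by omega, Forest.node hp hr ho h1, h2⟩

lemma Forest.eq_of_terminals {z w : List T} {k : ℕ} (h : g.Forest (z.map .terminal) w k) :
    w = z ∧ k = 0 := by
  induction z generalizing w k with
  | nil => cases h; simp
  | cons a z ih =>
    cases h with
    | term a h => simpa using ih h

lemma Forest.of_rule {r : ContextFreeRule T g.NT} (hr : r ∈ g.rules) {w : List T} {k : ℕ}
    (h : g.Forest r.output w k) : g.Forest [.nonterminal r.input] w (k + 1) := by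
  simpa using Forest.node (Path.refl r.input) hr h Forest.nil

lemma Forest.of_regular_rule {r : ContextFreeRule T g.NT} (hr : r ∈ g.rules)
    (hreg : IsRegularRule r) {w : List T} {k : ℕ} (h : g.Forest r.output w k) :
    g.Forest [.nonterminal r.input] w k := by
  rcases hreg with ⟨z, hz⟩ | ⟨z, B, hz⟩
  · rw [hz] at h
    obtain ⟨rfl, rfl⟩ := h.eq_of_terminals
    simpa using Forest.leaf (Path.refl r.input) hr hz Forest.nil
  · rw [hz] at h
    obtain ⟨w₁, w₂, k₁, k₂, rfl, rfl, h1, h2⟩ := h.split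
    obtain ⟨rfl, rfl⟩ := h1.eq_of_terminals
    cases h2 with
    | leaf hp hr' ho h' =>
      simpa using Forest.leaf (Path.step hr hz hp) hr' ho h'
    | node hp hr' ho h' =>
      simpa using Forest.node (Path.step hr hz hp) hr' ho h'

lemma Forest.of_rewrites {r : ContextFreeRule T g.NT} {u v : List (Symbol T g.NT)}
    {w : List T} {k d : ℕ} (huv : r.Rewrites u v) (h : g.Forest v w k)
    (hr : ∀ w k, g.Forest r.output w k → g.Forest [.nonterminal r.input] w (k + d)) :
    g.Forest u w (k + d) := by
  obtain ⟨p, q, rfl, rfl⟩ := huv.exists_parts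
  obtain ⟨w₁, w₂, k₁, k₂, rfl, rfl, h1, h2⟩ := h.split
  obtain ⟨w₃, w₄, k₃, k₄, rfl, rfl, h3, h4⟩ := h1.split
  have := (h3.append (hr _ _ h4)).append h2
  rwa [show k₃ + k₄ + k₂ + d = k₃ + (k₄ + d) + k₂ by omega]

end ContextFreeGrammar

lemma DerivesN.forest {T : Type} {g : ContextFreeGrammar T} {s : List (Symbol T g.NT)}
    {w : List T} {k : ℕ} (h : DerivesN g s (w.map .terminal) k) : g.Forest s w k := by
  generalize hv : w.map Symbol.terminal = v at h
  induction h with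
  | refl u =>
    subst hv
    exact ContextFreeGrammar.Forest.of_terminals w
  | regStep r hr hreg huv _ ih =>
    exact ContextFreeGrammar.Forest.of_rewrites (d := 0) huv (ih hv)
      fun _ _ => ContextFreeGrammar.Forest.of_regular_rule hr hreg
  | nonregStep r hr _ huv _ ih =>
    exact ContextFreeGrammar.Forest.of_rewrites huv (ih hv)
      fun _ _ => ContextFreeGrammar.Forest.of_rule hr

lemma ContextFreeGrammar.Derives.exists_derivesN {T : Type} {g : ContextFreeGrammar T}
    {s t : List (Symbol T g.NT)} (h : g.Derives s t) : ∃ k, DerivesN g s t k := by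
  induction h using Relation.ReflTransGen.head_induction_on with
  | refl => exact ⟨0, DerivesN.refl _⟩
  | head h _ ih =>
    obtain ⟨k, hk⟩ := ih
    obtain ⟨r, hr, huv⟩ := h
    by_cases hreg : IsRegularRule r
    · exact ⟨k, DerivesN.regStep r hr hreg huv hk⟩
    · exact ⟨k + 1, DerivesN.nonregStep r hr hreg huv hk⟩

namespace ContextFreeGrammar

variable {T : Type} {g : ContextFreeGrammar T}

/-- In the derivations of `W` from `s`, a factor between positions `i` and `j` can be pumped; its
length is a positive multiple of `N` and at most `K`. -/
def Pump (g : ContextFreeGrammar T) (N K : ℕ) (s : List (Symbol T g.NT)) (W : List T)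
    (i j : ℕ) : Prop :=
  ∃ a x b, W = a ++ x ++ b ∧ i ≤ a.length ∧ a.length + x.length ≤ j ∧ x ≠ [] ∧ x.length ≤ K ∧
    N ∣ x.length ∧ ∀ n, g.Derives s ((a ++ x.pow n ++ b).map .terminal)

lemma Pump.context {N K i₀ j₀ i j : ℕ} {s₀ s : List (Symbol T g.NT)} {W₀ : List T}
    (h : g.Pump N K s₀ W₀ i₀ j₀) (u v : List T)
    (hs : ∀ V, g.Derives s₀ (V.map .terminal) → g.Derives s ((u ++ V ++ v).map .terminal))
    (hi : i ≤ u.length + i₀) (hj : u.length + j₀ ≤ j) : g.Pump N K s (u ++ W₀ ++ v) i j := by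
  obtain ⟨a, x, b, rfl, h1, h2, h3, h4, h5, h6⟩ := h
  refine ⟨u ++ a, x, b ++ v, by simp, by rw [List.length_append]; omega,
    by rw [List.length_append]; omega, h3, h4, h5, fun n => ?_⟩
  simpa using hs _ (h6 n)

lemma Forest.exists_pump {R : ℕ} (hR : ∀ r ∈ g.rules, r.output.length ≤ R) {N : ℕ} (hN : 0 < N) :
    ∃ K > 0, ∃ K₁ K₂, ∀ s W k, g.Forest s W k → ∀ i j, j ≤ W.length →
      K₁ * s.length + K₂ * k + i < j → g.Pump N K s W i j := by
  obtain ⟨K, hK, hpath⟩ := Path.exists_pump hR hN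
  have hpump : ∀ (A C : g.NT) (y z : List T) (s : List (Symbol T g.NT)) (i j : ℕ),
      g.Path A y C → (∀ y, g.Path A y C → g.Derives s ((y ++ z).map .terminal)) →
      i + K ≤ y.length → i + K ≤ j → g.Pump N K s (y ++ z) i j := by
    intro A C y z s i j hy hs hi hj
    obtain ⟨a, x, b, X, rfl, h1, h2, h3, h4, h5, h6, h7⟩ := hpath A C y hy i hi
    refine ⟨a, x, b ++ z, by simp, h1, by omega, h3, by omega, h4, fun n => ?_⟩
    have := hs _ ((h5.trans (h6.pow n)).trans h7)
    simpa using this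
  set K₁ := K + R + 1 with hK₁
  set K₂ := K + K₁ * R with hK₂
  refine ⟨K, hK, K₁, K₂, fun s W k h => ?_⟩
  induction h with
  | nil => intro i j hj hlt; simp at hj; omega
  | @term a s w k h ih =>
    intro i j hj hlt
    simp only [List.length_cons, Nat.mul_succ] at hj hlt
    have := ih (i - 1) (j - 1) (by omega) (by omega)
    have := this.context (i := i) (j := j) [a] [] (s := .terminal a :: s) (fun V hV => by
      simpa using hV.append_left [.terminal a]) (by simp; omega) (by simp; omega)
    simpa using this
  | @leaf A r y z s w k hp hr ho h ih =>
    intro i j hj hlt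
    have hz : z.length ≤ R := by
      have := hR r hr
      rw [ho] at this
      simpa using this
    simp only [List.length_cons, List.length_append, Nat.mul_succ] at hj hlt
    have hder : ∀ y V, g.Path A y r.input → g.Derives s (V.map .terminal) →
        g.Derives (.nonterminal A :: s) ((y ++ z ++ V).map .terminal) := fun y V hy hV =>
      hy.derives_append hr (by rw [ho]) hV
    by_cases hy : i + K ≤ y.length
    · rw [List.append_assoc]
      refine hpump A r.input y _ _ i j hp (fun y hy => ?_) hy (by omega)
      rw [← List.append_assoc]
      exact hder y w hy h.derives
    · have := ih (i - (y.length + z.length)) (j - (y.length + z.length)) (by omega) (by omega)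
      have := this.context (i := i) (j := j) (y ++ z) [] (s := .nonterminal A :: s)
        (fun V hV => by simpa using hder y V hp hV)
        (by rw [List.length_append]; omega) (by rw [List.length_append]; omega)
      simpa using this
  | @node A r y z s w k₁ k₂ hp hr ho h ih₁ ih₂ =>
    intro i j hj hlt
    have hz : K₁ * r.output.length ≤ K₁ * R := Nat.mul_le_mul_left _ (hR r hr)
    simp only [List.length_cons, List.length_append, Nat.mul_add, mul_one] at hj hlt
    by_cases hy : i + K ≤ y.length
    · rw [List.append_assoc]
      refine hpump A r.input y _ _ i j hp (fun y hy => ?_) hy (by omega)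
      rw [← List.append_assoc]
      exact hy.derives_append hr ho.derives h.derives
    · by_cases hc : K₁ * r.output.length + K₂ * k₁ + (i - y.length) <
          min (j - y.length) z.length
      · have := ih₁ _ _ (min_le_right _ _) hc
        refine this.context y w (fun V hV => hp.derives_append hr hV h.derives)
          (by omega) (by omega)
      · have := ih₂ (i - (y.length + z.length)) (j - (y.length + z.length)) (by omega) (by omega)
        have := this.context (i := i) (j := j) (y ++ z) [] (s := .nonterminal A :: s)
          (fun V hV => by simpa using hp.derives_append hr ho.derives hV)
          (by rw [List.length_append]; omega) (by rw [List.length_append]; omega)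
        simpa using this

/-- The terminals that occur in the rules of a grammar. -/
def letters (g : ContextFreeGrammar T) : Set T := {b | ∃ r ∈ g.rules, .terminal b ∈ r.output}

lemma finite_letters (g : ContextFreeGrammar T) : g.letters.Finite := by
  have : g.letters = ⋃ r ∈ g.rules, (Symbol.terminal : T → Symbol T g.NT) ⁻¹'
      {x | x ∈ r.output} := by
    ext b
    simp [letters]
  rw [this]
  refine Set.Finite.biUnion g.rules.finite_toSet fun r _ => ?_
  refine Set.Finite.preimage (fun a _ b _ h => ?_) (List.finite_toSet r.output)
  simpa using h

lemma Derives.terminal_mem {s t : List (Symbol T g.NT)} (h : g.Derives s t) {b : T}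
    (hb : .terminal b ∈ t) : b ∈ g.letters ∨ .terminal b ∈ s := by
  induction h with
  | refl => exact Or.inr hb
  | tail _ h ih =>
    obtain ⟨r, hr, huv⟩ := h
    obtain ⟨p, q, rfl, rfl⟩ := huv.exists_parts
    simp only [List.mem_append] at hb
    rcases hb with (hb | hb) | hb
    · exact ih (by simp [hb])
    · exact Or.inl ⟨r, hr, hb⟩
    · exact ih (by simp [hb])

lemma mem_letters_of_mem_language {w : List T} (hw : w ∈ g.language) {b : T} (hb : b ∈ w) :
    b ∈ g.letters := by
  have := Derives.terminal_mem (b := b) hw (by simpa using hb)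
  simpa using this

end ContextFreeGrammar

lemma exists_derivesN_le_dnregFun {T : Type} {g : ContextFreeGrammar T} {w : List T}
    (hw : w ∈ g.language) :
    ∃ k ≤ dnregFun g w.length, DerivesN g [.nonterminal g.initial] (w.map .terminal) k := by
  have hne : {k | DerivesN g [.nonterminal g.initial] (w.map .terminal) k}.Nonempty :=
    ContextFreeGrammar.Derives.exists_derivesN hw
  refine ⟨dnregWord g w, ?_, Nat.sInf_mem hne⟩
  refine le_csSup ?_ ⟨w, rfl, rfl⟩
  refine Set.Finite.bddAbove ?_
  have : Finite g.letters := g.finite_letters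
  have hfin := (((List.finite_length_eq g.letters w.length).image
    (List.map Subtype.val)).image (dnregWord g)).insert 0
  refine hfin.subset ?_
  rintro _ ⟨v, hv, rfl⟩
  by_cases hvL : v ∈ g.language
  · refine Or.inr ⟨v, ⟨v.attach.map fun x => ⟨x.1, ?_⟩, ?_, ?_⟩, rfl⟩
    · exact ContextFreeGrammar.mem_letters_of_mem_language hvL x.2
    · simpa using hv
    · simp [Function.comp_def]
  · left
    have : {k | DerivesN g [.nonterminal g.initial] (v.map .terminal) k} = ∅ := by
      refine Set.eq_empty_of_forall_notMem fun k hk => hvL hk.forest.derives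
    rw [dnregWord, this, Nat.sInf_empty]

/-- A language generated with a sublinear degree of non-regularity has the pumping property. -/
lemma ContextFreeGrammar.pumpsPowers {T : Type} {g : ContextFreeGrammar T}
    (hg : ∀ C, ∃ m, ∀ n ≥ m, C * dnregFun g n ≤ n) : g.language.PumpsPowers := by
  intro v hv
  have hv' := List.length_pos_of_ne_nil hv
  obtain ⟨R, hR⟩ : ∃ R, ∀ r ∈ g.rules, r.output.length ≤ R :=
    ⟨g.rules.sup fun r => r.output.length, fun r hr =>
      Finset.le_sup (f := fun r : ContextFreeRule T g.NT => r.output.length) hr⟩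
  obtain ⟨K, hK, K₁, K₂, hpump⟩ := Forest.exists_pump hR hv'
  refine ⟨K.factorial, Nat.factorial_pos K, fun e => ?_⟩
  obtain ⟨m₀, hm₀⟩ := hg (2 * e * K₂)
  refine ⟨max m₀ (e * (2 * K₁ + 2) + 1), fun a b m hn hle hmem j => ?_⟩
  obtain ⟨k, hk, hder⟩ := exists_derivesN_le_dnregFun hmem
  have h1 := hm₀ _ (le_of_max_le_left hn)
  have h2 := (le_of_max_le_right hn).trans hle
  have he : 0 < e := by
    rcases Nat.eq_zero_or_pos e with rfl | he
    · omega
    · exact he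
  have h3 : 2 * K₁ + 2 ≤ m := by
    by_contra! hcon
    have := Nat.mul_le_mul_left e hcon.le
    omega
  have h4 : 2 * (K₂ * k) ≤ m := by
    have : e * (2 * (K₂ * k)) ≤ e * m := by
      calc e * (2 * (K₂ * k)) = 2 * e * K₂ * k := by ring
        _ ≤ _ := (Nat.mul_le_mul_left _ hk).trans (h1.trans hle)
    exact Nat.le_of_mul_le_mul_left this he
  have h5 : m ≤ m * v.length := Nat.le_mul_of_pos_right _ hv'
  obtain ⟨a', x, b', h6, h7, h8, h9, h10, ⟨c, hc⟩, h11⟩ :=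
    hpump _ _ _ hder.forest a.length (a.length + m * v.length) (by simp) (by simp; omega)
  obtain ⟨a'', rfl⟩ : a <+: a' := by
    refine List.prefix_of_prefix_length_le (l₃ := a ++ v.pow m ++ b) ?_ ?_ h7
    · rw [List.append_assoc]
      exact List.prefix_append _ _
    · rw [h6, List.append_assoc]
      exact List.prefix_append _ _
  obtain ⟨b'', rfl⟩ : b <:+ b' := by
    refine List.suffix_of_suffix_length_le (l₃ := a ++ v.pow m ++ b) ?_ ?_ ?_
    · exact List.suffix_append _ _
    · rw [h6]
      exact List.suffix_append _ _
    · have := congrArg List.length h6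
      simp only [List.length_append, List.length_pow'] at this h8
      omega
  have h12 : v.pow m = a'' ++ x ++ b'' := by
    have : a ++ (v.pow m ++ b) = a ++ (a'' ++ x ++ b'' ++ b) := by simpa using h6
    rw [List.append_cancel_left_eq, List.append_cancel_right_eq] at this
    exact this
  have hc0 : 0 < c := by
    rcases Nat.eq_zero_or_pos c with rfl | h
    · exact absurd (List.length_eq_zero_iff.1 (by simpa using hc)) h9
    · exact h
  obtain ⟨d, hd⟩ : c ∣ K.factorial := Nat.dvd_factorial hc0 (by nlinarith)
  have h13 := List.pow_eq_of_factor h12 (c := c) (by rw [hc, mul_comm]) (j * d)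
  rw [hd, show j * (c * d) = j * d * c by ring, ← h13]
  change g.Derives _ _
  simpa using h11 (j * d + 1)

/-- If a deterministic context-free language `L` is not regular and `L ∈ DNREG(f)`,
then `f(n) ∈ Ω(n)`. -/
theorem deterministic_nonregular_dnreg_lower_bound (T : Type) (L : Language T)
    (hdet : ∃ P : DPDA T, P.language = L) (hnr : ¬ L.IsRegular)
    (f : ℕ → ℕ) (hL : L ∈ DNREG T f) : InOmegaLinear f := by
  obtain ⟨P, rfl⟩ := hdet
  obtain ⟨g, hg, c, hc⟩ := hL
  by_contra hf
  refine hnr (DPDA.isRegular_of_pumpsPowers (T₀ := g.letters) ?_ g.finite_letters fun w hw b hb =>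
    ContextFreeGrammar.mem_letters_of_mem_language (hg ▸ hw) hb)
  rw [← hg]
  refine ContextFreeGrammar.pumpsPowers fun C => ?_
  simp only [InOmegaLinear, not_exists, not_and, not_forall, not_le] at hf
  obtain ⟨m, hm⟩ := hf (2 * C * c + 1) (by omega)
  refine ⟨max m (2 * C * c), fun n hn => ?_⟩
  have h1 := hm n (le_of_max_le_left hn)
  have h2 := le_of_max_le_right hn
  have h3 := Nat.mul_le_mul_left C (hc n)
  nlinarith
end
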